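/- Let K be a field, S = K[x,y,z,w] the polynomial ring in four variables over K, and I ⊆ S a monomial ideal. Then S/I is pretty clean if and only if S/I is sequentially Cohen–Macaulay. -/

import Mathlib

open MvPolynomial

/-- The depth of an `S`-module `M` with respect to an ideal `m`: the supremum of
lengths of `M`-regular sequences consisting of elements of `m`. -/
noncomputable def mDepth (S : Type*) [CommRing S] (m : Ideal S)
    (M : Type*) [AddCommGroup M] [Module S M] : ℕ∞ :=
  sSup {n : ℕ∞ | ∃ rs : List S, (rs.length : ℕ∞) = n ∧ (∀ r ∈ rs, r ∈ m) ∧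
    RingTheory.Sequence.IsRegular M rs}

/-- `M` is a Cohen–Macaulay `S`-module (w.r.t. the ideal `m`) if its depth with
respect to `m` equals its Krull dimension, i.e. the Krull dimension of `S ⧸ ann M`. -/
def IsCM (S : Type*) [CommRing S] (m : Ideal S)
    (M : Type*) [AddCommGroup M] [Module S M] : Prop :=
  (mDepth S m M : WithBot ℕ∞) = ringKrullDim (S ⧸ Module.annihilator S M)

/-- `F` is a prime filtration `I = F₀ ⊆ F₁ ⊆ ... ⊆ F_r = S` with
`F_i/F_{i-1} ≅ S/P_i` for prime ideals `P_i`. -/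
def IsPrimeFiltration {S : Type*} [CommRing S] (I : Ideal S) (r : ℕ)
    (F : Fin (r + 1) → Ideal S) (P : Fin r → Ideal S) : Prop :=
  F 0 = I ∧ F (Fin.last r) = ⊤ ∧ (∀ i : Fin r, F i.castSucc ≤ F i.succ) ∧
  ∀ i : Fin r, (P i).IsPrime ∧
    Nonempty ((↥(Submodule.map (F i.castSucc).mkQ (F i.succ))) ≃ₗ[S] (S ⧸ P i))

/-- `S/I` is clean: it has a prime filtration all of whose primes are minimal
primes of `I`. -/
def IsClean {S : Type*} [CommRing S] (I : Ideal S) : Prop :=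
  ∃ (r : ℕ) (F : Fin (r + 1) → Ideal S) (P : Fin r → Ideal S),
    IsPrimeFiltration I r F P ∧ ∀ i, P i ∈ I.minimalPrimes

/-- `S/I` is pretty clean: it has a prime filtration such that `i ≤ j` and
`P i ⊆ P j` imply `P i = P j`. -/
def IsPrettyClean {S : Type*} [CommRing S] (I : Ideal S) : Prop :=
  ∃ (r : ℕ) (F : Fin (r + 1) → Ideal S) (P : Fin r → Ideal S),
    IsPrimeFiltration I r F P ∧ ∀ i j : Fin r, i ≤ j → P i ≤ P j → P i = P j

/-- A (finitely generated) `S`-module `M` is clean: it has a filtration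
`0 = M₀ ⊆ M₁ ⊆ ... ⊆ M_r = M` with `M_i/M_{i-1} ≅ S/P_i` where each `P_i` is a
minimal prime of the support of `M`, i.e. a minimal prime over `ann M`. -/
def IsCleanModule (S : Type*) [CommRing S] (M : Type*) [AddCommGroup M] [Module S M] : Prop :=
  ∃ (r : ℕ) (F : Fin (r + 1) → Submodule S M) (P : Fin r → Ideal S),
    F 0 = ⊥ ∧ F (Fin.last r) = ⊤ ∧ (∀ i : Fin r, F i.castSucc ≤ F i.succ) ∧
    (∀ i : Fin r, (P i).IsPrime ∧
      Nonempty ((↥(F i.succ) ⧸ (Submodule.comap (F i.succ).subtype (F i.castSucc)))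
        ≃ₗ[S] (S ⧸ P i))) ∧
    ∀ i, P i ∈ (Module.annihilator S M).minimalPrimes

/-- An ideal of a polynomial ring is a monomial ideal if it is generated by monomials. -/
def IsMonomialIdeal {σ K : Type*} [CommSemiring K] (I : Ideal (MvPolynomial σ K)) : Prop :=
  ∃ G : Set (MvPolynomial σ K),
    (∀ g ∈ G, ∃ e : σ →₀ ℕ, g = MvPolynomial.monomial e 1) ∧ I = Ideal.span G

/-- The height of an ideal: the infimum of the heights of the primes containing it. -/
noncomputable def idealHeight {S : Type*} [CommRing S] (I : Ideal S) : ℕ∞ :=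
  sInf {n : ℕ∞ | ∃ q : PrimeSpectrum S, I ≤ q.asIdeal ∧ Order.height q = n}

variable {K : Type*} [Field K]

local notation "S" => MvPolynomial (Fin 4) K
local notation "m4" => (Ideal.span {(X 0 : MvPolynomial (Fin 4) K), X 1, X 2, X 3})

namespace PrettyClean

section Monomial

variable {σ : Type*} {A B : Ideal (MvPolynomial σ K)}

/-- An ideal containing every monomial occurring in one of its elements. -/
def SuppClosed (A : Ideal (MvPolynomial σ K)) : Prop :=
  ∀ f ∈ A, ∀ e ∈ f.support, monomial e (1 : K) ∈ A

lemma monomial_mem_of_le {e e' : σ →₀ ℕ} (h : e ≤ e') (he : monomial e (1 : K) ∈ A) :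
    monomial e' (1 : K) ∈ A := by
  obtain ⟨c, rfl⟩ := le_iff_exists_add.1 h
  have := A.mul_mem_left (monomial c 1) he
  rwa [monomial_mul, one_mul, add_comm] at this

lemma mem_of_support {f : MvPolynomial σ K}
    (h : ∀ e ∈ f.support, monomial e (1 : K) ∈ A) : f ∈ A := by
  rw [f.as_sum]
  refine A.sum_mem fun e he ↦ ?_
  have := A.mul_mem_left (C (f.coeff e)) (h e he)
  rwa [C_mul_monomial, mul_one] at this

lemma SuppClosed.le_iff (hA : SuppClosed A) :
    A ≤ B ↔ ∀ e, monomial e (1 : K) ∈ A → monomial e (1 : K) ∈ B :=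
  ⟨fun h _ he ↦ h he, fun h f hf ↦ mem_of_support fun e he ↦ h e (hA f hf e he)⟩

lemma SuppClosed.ext (hA : SuppClosed A) (hB : SuppClosed B)
    (h : ∀ e, monomial e (1 : K) ∈ A ↔ monomial e (1 : K) ∈ B) : A = B :=
  le_antisymm (hA.le_iff.2 fun e ↦ (h e).1) (hB.le_iff.2 fun e ↦ (h e).2)

lemma SuppClosed.mul_monomial_mem_iff (hA : SuppClosed A) {f : MvPolynomial σ K} {a : σ →₀ ℕ} :
    f * monomial a 1 ∈ A ↔ ∀ e ∈ f.support, monomial (e + a) (1 : K) ∈ A := by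
  constructor
  · intro h e he
    refine hA _ h _ ?_
    rw [mem_support_iff, coeff_mul_monomial, mul_one]
    exact mem_support_iff.1 he
  · intro h
    rw [f.as_sum, Finset.sum_mul]
    refine A.sum_mem fun e he ↦ ?_
    have := A.mul_mem_left (C (f.coeff e)) (h e he)
    rwa [monomial_mul, mul_one, ← mul_one (f.coeff e), ← C_mul_monomial]

lemma suppClosed_span_monomial (s : Set (σ →₀ ℕ)) :
    SuppClosed (Ideal.span ((fun e ↦ monomial e (1 : K)) '' s)) := by
  intro f hf e he
  obtain ⟨a, ha, hae⟩ := mem_ideal_span_monomial_image.1 hf e he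
  exact monomial_mem_of_le hae (Ideal.subset_span ⟨a, ha, rfl⟩)

lemma suppClosed_span_singleton (a : σ →₀ ℕ) :
    SuppClosed (Ideal.span {monomial a (1 : K)}) := by
  simpa using suppClosed_span_monomial (K := K) {a}

lemma monomial_mem_span_singleton {a e : σ →₀ ℕ} :
    monomial e (1 : K) ∈ Ideal.span {monomial a (1 : K)} ↔ a ≤ e := by
  classical
  have := mem_ideal_span_monomial_image (x := monomial e (1 : K)) (s := {a})
  simpa [support_monomial] using this

lemma _root_.IsMonomialIdeal.suppClosed {I : Ideal (MvPolynomial σ K)} (hI : IsMonomialIdeal I) :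
    SuppClosed I := by
  obtain ⟨G, hG, rfl⟩ := hI
  have : G = (fun e ↦ monomial e (1 : K)) '' {e | monomial e (1 : K) ∈ G} := by
    ext g
    constructor
    · intro hg
      obtain ⟨e, rfl⟩ := hG g hg
      exact ⟨e, hg, rfl⟩
    · rintro ⟨e, he, rfl⟩
      exact he
  rw [this]
  exact suppClosed_span_monomial _

lemma SuppClosed.sup (hA : SuppClosed A) (hB : SuppClosed B) : SuppClosed (A ⊔ B) := by
  classical
  intro f hf e he
  obtain ⟨a, ha, b, hb, rfl⟩ := Submodule.mem_sup.1 hf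
  rcases Finset.mem_union.1 (support_add he) with h | h
  · exact Ideal.mem_sup_left (hA a ha e h)
  · exact Ideal.mem_sup_right (hB b hb e h)

lemma SuppClosed.inf (hA : SuppClosed A) (hB : SuppClosed B) : SuppClosed (A ⊓ B) :=
  fun f hf e he ↦ ⟨hA f hf.1 e he, hB f hf.2 e he⟩

lemma SuppClosed.monomial_mem_sup (hA : SuppClosed A) (hB : SuppClosed B) {e : σ →₀ ℕ} :
    monomial e (1 : K) ∈ A ⊔ B ↔ monomial e (1 : K) ∈ A ∨ monomial e (1 : K) ∈ B := by
  classical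
  refine ⟨fun h ↦ ?_, fun h ↦ h.elim (fun h ↦ Ideal.mem_sup_left h) fun h ↦ Ideal.mem_sup_right h⟩
  obtain ⟨a, ha, b, hb, hab⟩ := Submodule.mem_sup.1 h
  have he : e ∈ (a + b).support := by
    rw [hab, support_monomial, if_neg one_ne_zero]
    exact Finset.mem_singleton_self e
  rcases Finset.mem_union.1 (support_add he) with h | h
  · exact .inl (hA a ha e h)
  · exact .inr (hB b hb e h)

lemma SuppClosed.monomial_mem_sup_span (hA : SuppClosed A) {a e : σ →₀ ℕ} :
    monomial e (1 : K) ∈ A ⊔ Ideal.span {monomial a 1} ↔ monomial e (1 : K) ∈ A ∨ a ≤ e := by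
  rw [hA.monomial_mem_sup (suppClosed_span_singleton a), monomial_mem_span_singleton]

/-- The ideal of all `f` with `f * a ∈ A`. -/
def colonBy {R : Type*} [CommRing R] (A : Ideal R) (a : R) : Ideal R :=
  Submodule.comap (LinearMap.mulRight R a) A

lemma mem_colonBy {R : Type*} [CommRing R] {A : Ideal R} {a f : R} :
    f ∈ colonBy A a ↔ f * a ∈ A := Iff.rfl

lemma SuppClosed.colonBy (hA : SuppClosed A) (a : σ →₀ ℕ) :
    SuppClosed (colonBy A (monomial a 1)) := by
  intro f hf e he
  rw [mem_colonBy, monomial_mul, one_mul]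
  exact hA.mul_monomial_mem_iff.1 hf e he

lemma monomial_mem_colonBy {a e : σ →₀ ℕ} :
    monomial e (1 : K) ∈ PrettyClean.colonBy A (monomial a 1) ↔ monomial (e + a) (1 : K) ∈ A := by
  rw [mem_colonBy, monomial_mul, one_mul]

end Monomial

section VarPrime

/-- If `φ` has a section `ψ` modulo `A ≤ ker φ`, then `A` is the kernel of `φ`. -/
lemma ker_eq_of_section {σ : Type*} {R : Type*} [CommRing R] [Algebra K R]
    (φ : MvPolynomial σ K →ₐ[K] R) (ψ : R →ₐ[K] MvPolynomial σ K)
    (A : Ideal (MvPolynomial σ K)) (h : ∀ i, X i - ψ (φ (X i)) ∈ A) (hA : ∀ f ∈ A, φ f = 0) :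
    RingHom.ker φ = A := by
  refine le_antisymm (fun f hf ↦ ?_) hA
  have : Ideal.Quotient.mkₐ K A = (Ideal.Quotient.mkₐ K A).comp (ψ.comp φ) := by
    refine algHom_ext fun i ↦ ?_
    simpa [Ideal.Quotient.eq] using h i
  have h2 := DFunLike.congr_fun this f
  rw [AlgHom.comp_apply, AlgHom.comp_apply, (RingHom.mem_ker).1 hf, map_zero, map_zero] at h2
  exact Ideal.Quotient.eq_zero_iff_mem.1 h2

variable (K) in
/-- The prime ideal generated by the variables in `T`. -/
noncomputable def varPrime (T : Finset (Fin 4)) : Ideal S := Ideal.span (X '' (T : Set (Fin 4)))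

lemma mem_varPrime {T : Finset (Fin 4)} {f : S} :
    f ∈ varPrime K T ↔ ∀ e ∈ f.support, ∃ i ∈ T, e i ≠ 0 := by
  exact mem_ideal_span_X_image (x := f) (s := (T : Set (Fin 4)))

lemma monomial_mem_varPrime {T : Finset (Fin 4)} {e : Fin 4 →₀ ℕ} :
    monomial e (1 : K) ∈ varPrime K T ↔ ∃ i ∈ T, e i ≠ 0 := by
  classical
  simp [mem_varPrime, support_monomial]

lemma X_mem_varPrime {T : Finset (Fin 4)} {i : Fin 4} : (X i : S) ∈ varPrime K T ↔ i ∈ T := by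
  rw [X, monomial_mem_varPrime]
  constructor
  · rintro ⟨j, hj, h⟩
    rcases eq_or_ne i j with rfl | hij
    · exact hj
    · simp [hij] at h
  · intro h
    exact ⟨i, h, by simp⟩

lemma suppClosed_varPrime (T : Finset (Fin 4)) : SuppClosed (varPrime K T) := by
  intro f hf e he
  exact monomial_mem_varPrime.2 (mem_varPrime.1 hf e he)

lemma varPrime_le_iff {T : Finset (Fin 4)} {A : Ideal S} :
    varPrime K T ≤ A ↔ ∀ i ∈ T, X i ∈ A := by
  simp [varPrime, Ideal.span_le, Set.subset_def]

lemma varPrime_le_varPrime {T T' : Finset (Fin 4)} :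
    varPrime K T ≤ varPrime K T' ↔ T ⊆ T' := by
  simp [varPrime_le_iff, X_mem_varPrime, Finset.subset_iff]

open Classical in
variable (K) in
/-- Restriction to the coordinate subspace where the variables in `T` vanish. -/
noncomputable def restrictVars (T : Finset (Fin 4)) : S →ₐ[K] MvPolynomial {i // i ∉ T} K :=
  aeval fun i ↦ if h : i ∉ T then X ⟨i, h⟩ else 0

lemma ker_restrictVars (T : Finset (Fin 4)) :
    RingHom.ker (restrictVars K T) = varPrime K T := by
  refine ker_eq_of_section _ (rename Subtype.val) _ (fun i ↦ ?_) fun f hf ↦ ?_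
  · by_cases h : i ∈ T
    · simp [restrictVars, h, X_mem_varPrime]
    · simp [restrictVars, h]
  · have : varPrime K T ≤ RingHom.ker (restrictVars K T) := by
      rw [varPrime_le_iff]
      intro i hi
      simp [restrictVars, hi]
    exact this hf

lemma isPrime_varPrime (T : Finset (Fin 4)) : (varPrime K T).IsPrime := by
  rw [← ker_restrictVars]
  exact RingHom.ker_isPrime _

lemma ringKrullDim_quotient_varPrime (T : Finset (Fin 4)) :
    ringKrullDim (S ⧸ varPrime K T) = (4 - T.card : ℕ) := by
  have hs : Function.Surjective (restrictVars K T) := by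
    rw [← AlgHom.range_eq_top, eq_top_iff, ← adjoin_range_X, Algebra.adjoin_le_iff]
    rintro _ ⟨⟨i, hi⟩, rfl⟩
    exact ⟨X i, by simp [restrictVars, hi]⟩
  rw [← ker_restrictVars, ringKrullDim_eq_of_ringEquiv
    (Ideal.quotientKerAlgEquivOfSurjective hs).toRingEquiv,
    ringKrullDim_of_isNoetherianRing, ringKrullDim_eq_zero_of_field, zero_add]
  simp

end VarPrime

section Colon

lemma exponent_induction {σ : Type*} {P : (σ →₀ ℕ) → Prop} (h0 : P 0)
    (hs : ∀ f i, P f → P (f + Finsupp.single i 1)) (f : σ →₀ ℕ) : P f := by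
  suffices ∀ f g : σ →₀ ℕ, P g → P (g + f) by simpa using this f 0 h0
  intro f
  induction f using Finsupp.induction_linear with
  | zero => simp
  | add f g hf hg => exact fun h hh ↦ add_assoc h f g ▸ hg _ (hf _ hh)
  | single a b =>
    induction b with
    | zero => simp
    | succ n ih =>
      intro g hg
      rw [Finsupp.single_add, ← add_assoc]
      exact hs _ _ (ih _ hg)

lemma colonBy_monomial_le {A : Ideal S} {e e' : Fin 4 →₀ ℕ} (h : e ≤ e') :
    colonBy A (monomial e 1) ≤ colonBy A (monomial e' 1) := by
  obtain ⟨c, rfl⟩ := le_iff_exists_add.1 h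
  intro f hf
  have := A.mul_mem_right (monomial c 1) hf
  rwa [LinearMap.mulRight_apply, mul_assoc, monomial_mul, one_mul] at this

/-- A monomial of a nonempty family, closed under those multiplications by variables in `V` which
stay outside `A`, whose colon ideal is prime in the directions of `V`. -/
lemma exists_colon_prime (A : Ideal S) (V : Finset (Fin 4)) (W : Set (Fin 4 →₀ ℕ))
    (hne : W.Nonempty) (hW : ∀ e ∈ W, monomial e (1 : K) ∉ A)
    (hcl : ∀ e ∈ W, ∀ i ∈ V, monomial (e + Finsupp.single i 1) (1 : K) ∉ A →
      e + Finsupp.single i 1 ∈ W) :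
    ∃ e ∈ W, ∀ s : Fin 4 →₀ ℕ, (∀ i, s i ≠ 0 → i ∈ V) → monomial (s + e) (1 : K) ∈ A →
      ∃ i ∈ V, s i ≠ 0 ∧ monomial (e + Finsupp.single i 1) (1 : K) ∈ A := by
  have hne' : ((fun e ↦ colonBy A (monomial e 1)) '' W).Nonempty := hne.image _
  obtain ⟨_, ⟨⟨e, he, rfl⟩, hmax⟩⟩ := set_has_maximal_iff_noetherian.2
    (inferInstanceAs (IsNoetherianRing S)) _ hne'
  refine ⟨e, he, ?_⟩
  by_contra! hcon
  obtain ⟨s, hsV, hsA, hs⟩ := hcon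
  have key : ∀ t : Fin 4 →₀ ℕ, t ≤ s →
      t + e ∈ W ∧ colonBy A (monomial (t + e) (1 : K)) = colonBy A (monomial e 1) := by
    refine exponent_induction (by simp [he]) fun t i ih hts ↦ ?_
    obtain ⟨h1, h2⟩ := ih (le_self_add.trans hts)
    have hsi : s i ≠ 0 := by
      have := hts i
      simp at this
      lia
    have h3 : monomial (t + e + Finsupp.single i 1) (1 : K) ∉ A := by
      rw [add_comm, ← monomial_mem_colonBy, h2, monomial_mem_colonBy, add_comm]
      exact hs i (hsV i hsi) hsi
    have h4 := hcl _ h1 i (hsV i hsi) h3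
    rw [add_right_comm]
    refine ⟨h4, (eq_of_le_of_not_lt (colonBy_monomial_le ?_)
      (hmax _ ⟨_, h4, rfl⟩)).symm⟩
    rw [add_right_comm]
    exact le_add_self
  exact hW _ (key s le_rfl).1 hsA

lemma exists_colon_single (A : Ideal S) (V : Finset (Fin 4)) (W : Set (Fin 4 →₀ ℕ))
    (hne : W.Nonempty) (hW : ∀ e ∈ W, monomial e (1 : K) ∉ A)
    (hcl : ∀ e ∈ W, ∀ i ∈ V, monomial (e + Finsupp.single i 1) (1 : K) ∉ A →
      e + Finsupp.single i 1 ∈ W)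
    (hN : ∀ e ∈ W, ∀ i ∈ V, ∃ N, monomial (e + Finsupp.single i N) (1 : K) ∈ A) :
    ∃ e ∈ W, ∀ i ∈ V, monomial (e + Finsupp.single i 1) (1 : K) ∈ A := by
  obtain ⟨e, he, h⟩ := exists_colon_prime A V W hne hW hcl
  refine ⟨e, he, fun i hi ↦ ?_⟩
  obtain ⟨N, hN⟩ := hN e he i hi
  obtain ⟨j, -, hj, h⟩ := h (Finsupp.single i N)
    (fun j hj ↦ by
      rcases eq_or_ne i j with rfl | hij
      · exact hi
      · simp [hij] at hj) (by rwa [add_comm])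
  rcases eq_or_ne i j with rfl | hij
  · exact h
  · simp [hij] at hj

lemma colonBy_eq_varPrime {A : Ideal S} (hA : SuppClosed A) {e : Fin 4 →₀ ℕ}
    {T : Finset (Fin 4)} :
    colonBy A (monomial e 1) = varPrime K T ↔
      ∀ s, monomial (s + e) (1 : K) ∈ A ↔ ∃ i ∈ T, s i ≠ 0 := by
  constructor
  · intro h s
    rw [← monomial_mem_colonBy, h, monomial_mem_varPrime]
  · intro h
    refine (hA.colonBy e).ext (suppClosed_varPrime T) fun s ↦ ?_
    rw [monomial_mem_colonBy, h, monomial_mem_varPrime]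

lemma exists_colonBy_eq_varPrime {A : Ideal S} (hA : SuppClosed A) (h : A ≠ ⊤) :
    ∃ e T, colonBy A (monomial e 1) = varPrime K T := by
  classical
  obtain ⟨e, -, he⟩ := exists_colon_prime A Finset.univ {e | monomial e (1 : K) ∉ A}
    ⟨0, fun h0 ↦ h (A.eq_top_iff_one.2 h0)⟩ (fun _ ↦ id) fun _ _ _ _ ↦ id
  refine ⟨e, Finset.univ.filter fun i ↦ monomial (e + Finsupp.single i 1) (1 : K) ∈ A,
    (colonBy_eq_varPrime hA).2 fun s ↦ ⟨fun hs ↦ ?_, ?_⟩⟩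
  · obtain ⟨i, -, h1, h2⟩ := he s (by simp) hs
    exact ⟨i, by simpa using h2, h1⟩
  · rintro ⟨i, hi, hsi⟩
    refine monomial_mem_of_le ?_ (Finset.mem_filter.1 hi).2
    rw [add_comm]
    gcongr
    simp
    lia

/-- The associated primes of a monomial ideal are generated by variables. -/
lemma SuppClosed.eq_varPrime {A : Ideal S} (hA : SuppClosed A) {p : Ideal S} (hp : p.IsPrime)
    {f : S} (hf : PrettyClean.colonBy A f = p) : ∃ T, p = varPrime K T := by
  induction A using WellFoundedGT.induction with
  | ind A ih =>
  have hA' : A ≠ ⊤ := by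
    rintro rfl
    exact hp.ne_top (hf ▸ rfl)
  obtain ⟨e, T, hT⟩ := exists_colonBy_eq_varPrime hA hA'
  have hpf : ∀ {s}, s ∈ p ↔ s * f ∈ A := fun {s} ↦ by rw [← hf, mem_colonBy]
  have hTe : ∀ {s}, s ∈ varPrime K T ↔ s * monomial e 1 ∈ A := fun {s} ↦ by rw [← hT, mem_colonBy]
  have heA : monomial e (1 : K) ∉ A := fun h ↦
    (isPrime_varPrime (K := K) T).ne_top ((Ideal.eq_top_iff_one _).2 (hTe.2 (by simpa using h)))
  by_cases hs : ∃ s ∉ p, s * f ∈ A ⊔ Ideal.span {monomial e 1}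
  · obtain ⟨s, hsp, hs⟩ := hs
    obtain ⟨a, ha, b, hb, hab⟩ := Submodule.mem_sup.1 hs
    obtain ⟨r, rfl⟩ := Ideal.mem_span_singleton'.1 hb
    have hr : ∀ g, g ∈ p ↔ g * r ∈ varPrime K T := by
      intro g
      have : g ∈ p ↔ g * s ∈ p := ⟨fun h ↦ p.mul_mem_right _ h,
        fun h ↦ (hp.mem_or_mem h).resolve_right hsp⟩
      rw [this, hpf, hTe, mul_assoc, ← hab, mul_add, A.add_mem_iff_right (A.mul_mem_left g ha),
        mul_assoc]
    have hrT : r ∉ varPrime K T := fun h ↦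
      hp.ne_top ((Ideal.eq_top_iff_one _).2 ((hr 1).2 (by simpa using h)))
    refine ⟨T, Ideal.ext fun g ↦ (hr g).trans ⟨fun h ↦ ?_, fun h ↦ Ideal.mul_mem_right _ _ h⟩⟩
    exact ((isPrime_varPrime T).mem_or_mem h).resolve_right hrT
  · push Not at hs
    refine ih (A ⊔ Ideal.span {monomial e 1}) ?_ (hA.sup (suppClosed_span_singleton e)) ?_
    · refine lt_of_le_of_ne le_sup_left fun h ↦ heA ?_
      rw [h]
      exact Ideal.mem_sup_right (Ideal.mem_span_singleton_self _)
    · ext s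
      rw [mem_colonBy]
      refine ⟨fun h ↦ by_contra fun h' ↦ hs s h' h, fun h ↦ Ideal.mem_sup_left (hpf.1 h)⟩

lemma colonBy_eq_of_mem_associatedPrimes {R : Type*} [CommRing R] [IsNoetherianRing R]
    {I p : Ideal R} : p ∈ associatedPrimes R (R ⧸ I) ↔ p.IsPrime ∧ ∃ f, colonBy I f = p := by
  change IsAssociatedPrime p _ ↔ _
  rw [isAssociatedPrime_iff]
  refine and_congr_right fun _ ↦ ⟨?_, ?_⟩
  · rintro ⟨x, rfl⟩
    obtain ⟨f, rfl⟩ := Ideal.Quotient.mk_surjective x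
    refine ⟨f, Ideal.ext fun s ↦ ?_⟩
    rw [mem_colonBy, ← Ideal.Quotient.eq_zero_iff_mem, Submodule.mem_colon_singleton]
    rfl
  · rintro ⟨f, rfl⟩
    refine ⟨Ideal.Quotient.mk I f, Ideal.ext fun s ↦ ?_⟩
    rw [mem_colonBy, ← Ideal.Quotient.eq_zero_iff_mem, Submodule.mem_colon_singleton]
    rfl

lemma SuppClosed.exists_eq_varPrime {A : Ideal S} (hA : SuppClosed A) {p : Ideal S}
    (hp : p ∈ associatedPrimes S (S ⧸ A)) : ∃ T, p = varPrime K T := by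
  obtain ⟨hp, f, hf⟩ := colonBy_eq_of_mem_associatedPrimes.1 hp
  exact hA.eq_varPrime hp hf

end Colon

section Saturation

/-- The exponent of the product of the variables in `U`. -/
noncomputable def ind (U : Finset (Fin 4)) : Fin 4 →₀ ℕ := Finsupp.indicator U fun _ _ ↦ 1

lemma ind_apply (U : Finset (Fin 4)) (i : Fin 4) : ind U i = if i ∈ U then 1 else 0 := by
  simp [ind, Finsupp.indicator_apply]

/-- The saturation of `A` with respect to the product of the variables in `U`. -/
noncomputable def sat (U : Finset (Fin 4)) (A : Ideal S) : Ideal S where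
  carrier := {f | ∃ N : ℕ, f * monomial (N • ind U) 1 ∈ A}
  zero_mem' := ⟨0, by simp⟩
  add_mem' := by
    rintro f g ⟨M, hM⟩ ⟨N, hN⟩
    refine ⟨M + N, ?_⟩
    have h : (monomial ((M + N) • ind U) (1 : K)) =
        monomial (M • ind U) 1 * monomial (N • ind U) 1 := by
      rw [monomial_mul, one_mul, add_smul]
    rw [h, add_mul]
    refine A.add_mem ?_ ?_
    · rw [← mul_assoc]
      exact A.mul_mem_right _ hM
    · rw [mul_left_comm]
      exact A.mul_mem_left _ hN
  smul_mem' := by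
    rintro c f ⟨M, hM⟩
    exact ⟨M, by rw [smul_eq_mul, mul_assoc]; exact A.mul_mem_left _ hM⟩

variable {A B : Ideal (MvPolynomial (Fin 4) K)} {U V : Finset (Fin 4)}

lemma mem_sat {f : S} : f ∈ sat U A ↔ ∃ N : ℕ, f * monomial (N • ind U) 1 ∈ A := Iff.rfl

lemma monomial_mem_sat {e : Fin 4 →₀ ℕ} :
    monomial e (1 : K) ∈ sat U A ↔ ∃ N : ℕ, monomial (e + N • ind U) (1 : K) ∈ A := by
  simp [mem_sat, monomial_mul]

lemma mem_sat_of_le {N N' : ℕ} (h : N ≤ N') {f : S} (hf : f * monomial (N • ind U) 1 ∈ A) :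
    f * monomial (N' • ind U) 1 ∈ A := by
  obtain ⟨k, rfl⟩ := Nat.exists_eq_add_of_le h
  have := A.mul_mem_right (monomial (k • ind U) 1) hf
  rwa [mul_assoc, monomial_mul, one_mul, ← add_smul] at this

lemma SuppClosed.sat (hA : SuppClosed A) (U : Finset (Fin 4)) : SuppClosed (sat U A) := by
  rintro f ⟨N, hN⟩ e he
  exact monomial_mem_sat.2 ⟨N, hA.mul_monomial_mem_iff.1 hN e he⟩

lemma le_sat : A ≤ sat U A := fun f hf ↦ ⟨0, by simpa using hf⟩

lemma sat_mono (h : A ≤ B) : sat U A ≤ sat U B := fun _ ⟨N, hN⟩ ↦ ⟨N, h hN⟩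

lemma sat_le_sat (h : U ⊆ V) : sat U A ≤ sat V A := by
  rintro f ⟨N, hN⟩
  refine ⟨N, ?_⟩
  have hle : N • ind U ≤ N • ind V := by
    intro i
    simp only [Finsupp.smul_apply, ind_apply]
    split_ifs with h1 h2
    · rfl
    · exact absurd (h h1) h2
    · simp
    · rfl
  obtain ⟨c, hc⟩ := le_iff_exists_add.1 hle
  have := A.mul_mem_right (monomial c 1) hN
  rwa [mul_assoc, monomial_mul, one_mul, ← hc] at this

lemma sat_sat : sat U (sat U A) = sat U A := by
  refine le_antisymm ?_ le_sat
  rintro f ⟨N, M, h⟩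
  refine ⟨N + M, ?_⟩
  rwa [mul_assoc, monomial_mul, one_mul, ← add_smul] at h

lemma mem_sat_colonBy {a f : S} : f ∈ sat U (colonBy A a) ↔ f * a ∈ sat U A := by
  simp only [mem_sat, mem_colonBy, mul_right_comm]

lemma mul_monomial_mem_sat {f : S} {N : ℕ} :
    f * monomial (N • ind U) 1 ∈ sat U A ↔ f ∈ sat U A := by
  refine ⟨fun h ↦ ?_, fun h ↦ Ideal.mul_mem_right _ _ h⟩
  rw [← sat_sat]
  exact ⟨N, h⟩

/-- The intersection of the saturations with respect to all sets of `d` variables. -/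
noncomputable def satDim (d : ℕ) (A : Ideal S) : Ideal S :=
  ⨅ U : {U : Finset (Fin 4) // U.card = d}, sat U.1 A

lemma mem_satDim {d : ℕ} {f : S} : f ∈ satDim d A ↔ ∀ U, U.card = d → f ∈ sat U A := by
  simp [satDim]

lemma SuppClosed.satDim (hA : SuppClosed A) (d : ℕ) : SuppClosed (satDim d A) := by
  intro f hf e he
  rw [mem_satDim] at hf ⊢
  exact fun U hU ↦ hA.sat U f (hf U hU) e he

lemma satDim_zero : satDim 0 A = A := by
  ext f
  simp only [mem_satDim, Finset.card_eq_zero, forall_eq, mem_sat]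
  have : ind ∅ = 0 := by ext; simp [ind_apply]
  simp [this]

lemma satDim_le_sat : satDim U.card A ≤ sat U A := fun _ hf ↦ mem_satDim.1 hf U rfl

lemma le_satDim {d : ℕ} : A ≤ satDim d A := fun _ hf ↦ mem_satDim.2 fun _ _ ↦ le_sat hf

lemma satDim_le_satDim {d d' : ℕ} (h : d ≤ d') : satDim d A ≤ satDim d' A := by
  intro f hf
  refine mem_satDim.2 fun U hU ↦ ?_
  obtain ⟨V, hV, hVd⟩ := Finset.exists_subset_card_eq (hU ▸ h)
  exact sat_le_sat hV (mem_satDim.1 hf V hVd)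

lemma satDim_mono {d : ℕ} (h : A ≤ B) : satDim d A ≤ satDim d B :=
  fun _ hf ↦ mem_satDim.2 fun U hU ↦ sat_mono h (mem_satDim.1 hf U hU)

lemma sat_satDim : sat U (satDim U.card A) = sat U A :=
  le_antisymm ((sat_mono satDim_le_sat).trans sat_sat.le) (sat_mono le_satDim)

lemma sat_univ_eq_top (hA : SuppClosed A) (h : A ≠ ⊥) : sat Finset.univ A = ⊤ := by
  obtain ⟨f, hf, h0⟩ := Submodule.exists_mem_ne_zero_of_ne_bot h
  obtain ⟨e, he⟩ := support_nonempty.2 h0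
  rw [Ideal.eq_top_iff_one]
  refine ⟨e.degree, ?_⟩
  rw [one_mul]
  refine monomial_mem_of_le (fun i ↦ ?_) (hA f hf e he)
  simpa [ind_apply] using Finsupp.le_degree i e

lemma satDim_four (hA : SuppClosed A) (h : A ≠ ⊥) : satDim 4 A = ⊤ := by
  rw [eq_top_iff]
  intro f _
  refine mem_satDim.2 fun U hU ↦ ?_
  rw [(Finset.card_eq_iff_eq_univ U).1 (by simpa using hU), sat_univ_eq_top hA h]
  trivial

lemma monomial_ind_mem_varPrime {T : Finset (Fin 4)} {N : ℕ} (hN : N ≠ 0) :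
    monomial (N • ind U) (1 : K) ∈ varPrime K T ↔ ¬ Disjoint U T := by
  simp [monomial_mem_varPrime, ind_apply, hN, Finset.not_disjoint_iff, and_comm]

/-- The components of the dimension filtration of a monomial ideal are intersections of
saturations. -/
lemma iInf_primary_eq_satDim (hA : SuppClosed A) (Q : Ideal S → Ideal S)
    (hQ : ∀ p ∈ associatedPrimes S (S ⧸ A), (Q p).IsPrimary ∧ (Q p).radical = p)
    (hdec : A = ⨅ p ∈ associatedPrimes S (S ⧸ A), Q p) {i : ℕ} :
    (⨅ p ∈ {p | p ∈ associatedPrimes S (S ⧸ A) ∧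
        (i : WithBot ℕ∞) < ringKrullDim (S ⧸ p)}, Q p) = satDim (i + 1) A := by
  have hdim : ∀ T : Finset (Fin 4), (i : WithBot ℕ∞) < ringKrullDim (S ⧸ varPrime K T) ↔
      i < 4 - T.card := by
    intro T
    rw [ringKrullDim_quotient_varPrime]
    exact Nat.cast_lt (α := WithBot ℕ∞)
  have hcard : ∀ T : Finset (Fin 4), T.card ≤ 4 := fun T ↦ T.card_le_univ
  refine le_antisymm (fun f hf ↦ mem_satDim.2 fun U hU ↦ ?_) fun f hf ↦ ?_
  · have hex : ∀ p ∈ associatedPrimes S (S ⧸ A), ∃ N : ℕ, f * monomial (N • ind U) 1 ∈ Q p := by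
      intro p hp
      by_cases hpi : (i : WithBot ℕ∞) < ringKrullDim (S ⧸ p)
      · exact ⟨0, Ideal.mul_mem_right _ _ ((Submodule.mem_iInf _).1
          ((Submodule.mem_iInf _).1 hf p) ⟨hp, hpi⟩)⟩
      · obtain ⟨T, rfl⟩ := hA.exists_eq_varPrime hp
        rw [hdim] at hpi
        have h1 : monomial (1 • ind U) (1 : K) ∈ varPrime K T := by
          rw [monomial_ind_mem_varPrime one_ne_zero]
          intro hd
          have := Finset.card_union_of_disjoint hd
          have := hcard (U ∪ T)
          have := hcard T
          lia
        rw [← (hQ _ hp).2] at h1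
        obtain ⟨N, hN⟩ := h1
        rw [monomial_pow, one_pow, one_smul] at hN
        exact ⟨N, Ideal.mul_mem_left _ _ hN⟩
    choose! n hn using hex
    have hfin := associatedPrimes.finite S (S ⧸ A)
    refine ⟨hfin.toFinset.sup n, ?_⟩
    refine hdec.ge ?_
    simp only [Submodule.mem_iInf]
    intro p hp
    exact mem_sat_of_le (Finset.le_sup (hfin.mem_toFinset.2 hp)) (hn p hp)
  · simp only [Submodule.mem_iInf]
    rintro p ⟨hp, hpi⟩
    obtain ⟨T, rfl⟩ := hA.exists_eq_varPrime hp
    rw [hdim] at hpi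
    obtain ⟨U, hUT, hU⟩ := Finset.exists_subset_card_eq
      (show i + 1 ≤ Tᶜ.card by rw [Finset.card_compl, Fintype.card_fin]; lia)
    obtain ⟨N, hN⟩ := mem_satDim.1 hf U hU
    have hN' := mem_sat_of_le (Nat.le_succ N) hN
    have hle : A ≤ Q (varPrime K T) := by
      conv_lhs => rw [hdec]
      exact iInf₂_le _ hp
    refine ((Ideal.isPrimary_iff.1 (hQ _ hp).1).2 (hle hN')).resolve_right ?_
    rw [(hQ _ hp).2, monomial_ind_mem_varPrime N.succ_ne_zero, not_not]
    exact Finset.disjoint_left.2 fun i hiU hiT ↦ Finset.mem_compl.1 (hUT hiU) hiT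

end Saturation

section Filtration

/-- There is a chain of ideals from `A` to `B` whose successive quotients are of the form
`S ⧸ P` with `P` generated by variables and of dimension `d`. -/
inductive Filt (d : ℕ) : Ideal (MvPolynomial (Fin 4) K) → Ideal (MvPolynomial (Fin 4) K) → Prop
  | refl (A : Ideal (MvPolynomial (Fin 4) K)) : Filt d A A
  | step {A B : Ideal (MvPolynomial (Fin 4) K)} (a : MvPolynomial (Fin 4) K) (T : Finset (Fin 4))
      (hT : T.card + d = 4) (ha : colonBy A a = varPrime K T)
      (h : Filt d (A ⊔ Ideal.span {a}) B) : Filt d A B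

lemma Filt.le {d : ℕ} {A B : Ideal S} (h : Filt d A B) : A ≤ B := by
  induction h with
  | refl A => exact le_rfl
  | step a T hT ha h ih => exact le_sup_left.trans ih

lemma Filt.trans {d : ℕ} {A B C : Ideal S} (h : Filt d A B) (h' : Filt d B C) : Filt d A C := by
  induction h with
  | refl A => exact h'
  | step a T hT ha h ih => exact .step a T hT ha (ih h')

lemma Filt.mul {d : ℕ} {A B J : Ideal S} (h : Filt d A B) {a : S} (hJ : colonBy J a ≤ A) :
    Filt d (J ⊔ A * Ideal.span {a}) (J ⊔ B * Ideal.span {a}) := by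
  induction h with
  | refl A => exact .refl _
  | @step A B b T hT hb h ih =>
    have ih := ih (hJ.trans le_sup_left)
    rw [Ideal.sup_mul, Ideal.span_singleton_mul_span_singleton, ← sup_assoc] at ih
    refine .step (b * a) T hT ?_ ih
    rw [← hb]
    ext f
    rw [mem_colonBy, mem_colonBy, Submodule.mem_sup]
    constructor
    · rintro ⟨j, hj, c, hc, h⟩
      obtain ⟨z, hz, rfl⟩ := Ideal.mem_mul_span_singleton.1 hc
      have : f * b - z ∈ A := hJ (by
        rw [mem_colonBy, sub_mul, mul_assoc, ← h, add_sub_cancel_right]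
        exact hj)
      simpa using A.add_mem this hz
    · intro h
      exact ⟨0, J.zero_mem, f * b * a, Ideal.mem_mul_span_singleton.2 ⟨_, h, rfl⟩, by ring⟩

lemma Filt.of_colonBy {d : ℕ} {J : Ideal S} {a : S} (h : Filt d (colonBy J a) ⊤) :
    Filt d J (J ⊔ Ideal.span {a}) := by
  have := h.mul le_rfl
  rwa [Ideal.top_mul, sup_eq_left.2] at this
  intro f hf
  obtain ⟨z, hz, rfl⟩ := Ideal.mem_mul_span_singleton.1 hf
  exact hz

lemma filt_varPrime_sup_span {d : ℕ} {T : Finset (Fin 4)} (hT : T.card + d + 1 = 4)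
    (v : Fin 4 →₀ ℕ) (hv : ∀ i ∈ T, v i = 0) :
    Filt d (varPrime K T ⊔ Ideal.span {monomial v 1}) ⊤ := by
  induction v using exponent_induction with
  | h0 =>
    have : varPrime K T ⊔ Ideal.span {monomial 0 1} = ⊤ := by
      rw [Ideal.eq_top_iff_one]
      exact Ideal.mem_sup_right (Ideal.mem_span_singleton_self _)
    rw [this]
    exact .refl _
  | hs v l ih =>
    have hl : l ∉ T := fun h ↦ by simpa using hv l h
    have hv' : ∀ i ∈ T, v i = 0 := fun i hi ↦ by
      have := hv i hi
      simp only [Finsupp.add_apply] at this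
      lia
    refine .step (monomial v 1) (insert l T) (by rw [Finset.card_insert_of_notMem hl]; lia) ?_ ?_
    · rw [colonBy_eq_varPrime ((suppClosed_varPrime T).sup (suppClosed_span_singleton _))]
      intro s
      rw [(suppClosed_varPrime T).monomial_mem_sup_span, monomial_mem_varPrime]
      constructor
      · rintro (⟨i, hi, h⟩ | h)
        · exact ⟨i, Finset.mem_insert_of_mem hi, by simpa [hv' i hi] using h⟩
        · refine ⟨l, Finset.mem_insert_self _ _, ?_⟩
          have := h l
          simp at this
          lia
      · rintro ⟨i, hi, h⟩
        rcases Finset.mem_insert.1 hi with rfl | hi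
        · right
          rw [add_comm]
          gcongr
          simp
          lia
        · exact .inl ⟨i, hi, by simp [h]⟩
    · have hle : Ideal.span {monomial (v + Finsupp.single l 1) (1 : K)} ≤
          Ideal.span {monomial v 1} := by
        rw [Ideal.span_singleton_le_iff_mem, monomial_mem_span_singleton]
        exact le_self_add
      rw [sup_assoc, sup_eq_right.2 hle]
      exact ih hv'

lemma smul_ind_singleton (N : ℕ) (j : Fin 4) : N • ind {j} = Finsupp.single j N := by
  ext i
  simp [ind_apply, Finsupp.single_apply, eq_comm]

lemma monomial_mem_sat_of_le {A : Ideal S} {U : Finset (Fin 4)} {e e' : Fin 4 →₀ ℕ}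
    (h : ∀ i ∉ U, e i ≤ e' i) (he : monomial e (1 : K) ∈ sat U A) :
    monomial e' (1 : K) ∈ sat U A := by
  rw [monomial_mem_sat] at he ⊢
  obtain ⟨N, hN⟩ := he
  refine ⟨N + e.degree, monomial_mem_of_le (fun i ↦ ?_) hN⟩
  simp only [Finsupp.add_apply, Finsupp.smul_apply, ind_apply, smul_eq_mul]
  by_cases hi : i ∈ U
  · have := Finsupp.le_degree i e
    simp only [hi, if_true]
    lia
  · simpa [hi] using h i hi

lemma filt_zero {A B : Ideal S} (hA : SuppClosed A) (hB : SuppClosed B) (hAB : A ≤ B)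
    (h : ∀ j, B ≤ sat {j} A) : Filt 0 A B := by
  induction A using WellFoundedGT.induction with
  | ind A ih =>
  rcases hAB.eq_or_lt with rfl | hlt
  · exact .refl _
  have hne : {e | monomial e (1 : K) ∈ B ∧ monomial e (1 : K) ∉ A}.Nonempty := by
    have := mt hB.le_iff.2 hlt.not_ge
    push Not at this
    exact this
  obtain ⟨e, ⟨heB, heA⟩, he⟩ := exists_colon_single A Finset.univ _ hne (fun e he ↦ he.2)
    (fun e he i _ hi ↦ ⟨monomial_mem_of_le le_self_add he.1, hi⟩)
    (fun e he i _ ↦ by simpa [monomial_mem_sat, smul_ind_singleton] using h i he.1)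
  have hsp : Ideal.span {monomial e (1 : K)} ≤ B := (Ideal.span_singleton_le_iff_mem _).2 heB
  refine .step (monomial e 1) Finset.univ rfl ((colonBy_eq_varPrime hA).2 fun s ↦ ⟨?_, ?_⟩)
    (ih _ ?_ (hA.sup (suppClosed_span_singleton e)) (sup_le hAB hsp)
      fun j ↦ (h j).trans (sat_mono le_sup_left))
  · contrapose!
    intro hs
    have : s = 0 := by ext i; exact hs i (Finset.mem_univ i)
    simpa [this] using heA
  · rintro ⟨i, -, hi⟩
    refine monomial_mem_of_le ?_ (he i (Finset.mem_univ i))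
    rw [add_comm]
    gcongr
    simp
    lia
  · refine lt_of_le_of_ne le_sup_left fun h ↦ heA ?_
    rw [h]
    exact Ideal.mem_sup_right (Ideal.mem_span_singleton_self _)

lemma filt_one {A B : Ideal S} (hA : SuppClosed A) (hB : SuppClosed B) (hAB : A ≤ B)
    (h2 : ∀ U : Finset (Fin 4), U.card = 2 → B ≤ sat U A)
    (h1 : ∀ e, monomial e (1 : K) ∈ B → (∀ j, monomial e (1 : K) ∈ sat {j} A) →
      monomial e (1 : K) ∈ A) : Filt 1 A B := by
  induction A using WellFoundedGT.induction with
  | ind A ih =>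
  rcases hAB.eq_or_lt with rfl | hlt
  · exact .refl _
  obtain ⟨e₀, he₀B, he₀A⟩ : ∃ e, monomial e (1 : K) ∈ B ∧ monomial e (1 : K) ∉ A := by
    have := mt hB.le_iff.2 hlt.not_ge
    push Not at this
    exact this
  obtain ⟨i, hi⟩ : ∃ i, monomial e₀ (1 : K) ∉ sat {i} A := by
    by_contra! hcon
    exact he₀A (h1 e₀ he₀B hcon)
  set W : Set (Fin 4 →₀ ℕ) := {e | monomial e (1 : K) ∈ B ∧ monomial e (1 : K) ∉ A ∧
    ∀ j ≠ i, monomial e (1 : K) ∈ sat {j} A} with hWdef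
  have hWi : ∀ e ∈ W, monomial e (1 : K) ∉ sat {i} A := by
    rintro e ⟨heB, heA, he⟩ hei
    refine heA (h1 e heB fun j ↦ ?_)
    by_cases hj : j = i
    · exact hj ▸ hei
    · exact he j hj
  have hWne : W.Nonempty := by
    have hN : ∀ j ≠ i, ∃ N : ℕ, monomial (e₀ + N • ind {i, j}) (1 : K) ∈ A := fun j hj ↦
      monomial_mem_sat.1 (h2 {i, j} (Finset.card_pair hj.symm) he₀B)
    choose! n hn using hN
    refine ⟨e₀ + Finsupp.single i (Finset.univ.sup n), monomial_mem_of_le le_self_add he₀B,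
      fun h ↦ hi (monomial_mem_sat.2 ⟨_, by rwa [smul_ind_singleton]⟩), fun j hj ↦ ?_⟩
    refine monomial_mem_sat.2 ⟨n j, monomial_mem_of_le (fun k ↦ ?_) (hn j hj)⟩
    have hnj : n j ≤ Finset.univ.sup n := Finset.le_sup (Finset.mem_univ j)
    simp only [Finsupp.add_apply, Finsupp.smul_apply, ind_apply, Finset.mem_insert,
      Finset.mem_singleton, Finsupp.single_apply, smul_eq_mul]
    split_ifs <;> simp_all
  set W' : Set (Fin 4 →₀ ℕ) := {e | e ∈ W ∧
    ∀ j ≠ i, monomial (e + Finsupp.single j 1) (1 : K) ∈ A} with hW'def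
  have hW'ne : W'.Nonempty := by
    obtain ⟨e, he, h⟩ := exists_colon_single A (Finset.univ.erase i) W hWne (fun e he ↦ he.2.1)
      (fun e he j hj hej ↦ ⟨monomial_mem_of_le le_self_add he.1, hej, fun k hk ↦
        monomial_mem_of_le le_self_add (he.2.2 k hk)⟩)
      (fun e he j hj ↦ by
        simpa [monomial_mem_sat, smul_ind_singleton] using he.2.2 j (Finset.ne_of_mem_erase hj))
    exact ⟨e, he, fun j hj ↦ h j (Finset.mem_erase.2 ⟨hj, Finset.mem_univ j⟩)⟩
  obtain ⟨e, ⟨heW, he⟩, hmin⟩ := exists_minimalFor_of_wellFoundedLT (· ∈ W') (fun e ↦ e i) hW'ne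
  have hsp : Ideal.span {monomial e (1 : K)} ≤ B := (Ideal.span_singleton_le_iff_mem _).2 heW.1
  have hcol : ∀ s : Fin 4 →₀ ℕ, monomial (s + e) (1 : K) ∈ A ↔
      ∃ j ∈ Finset.univ.erase i, s j ≠ 0 := by
    intro s
    constructor
    · contrapose!
      intro hs hsA
      refine hWi e heW (monomial_mem_sat.2 ⟨s i, ?_⟩)
      convert hsA using 2
      rw [smul_ind_singleton, add_comm]
      congr 1
      ext j
      by_cases hj : i = j
      · simp [hj]
      · simp [hj, hs j (Finset.mem_erase.2 ⟨Ne.symm hj, Finset.mem_univ j⟩)]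
    · rintro ⟨j, hj, hsj⟩
      refine monomial_mem_of_le ?_ (he j (Finset.ne_of_mem_erase hj))
      rw [add_comm]
      gcongr
      simp
      lia
  refine .step (monomial e 1) (Finset.univ.erase i) (by simp)
    ((colonBy_eq_varPrime hA).2 hcol)
    (ih _ ?_ (hA.sup (suppClosed_span_singleton e)) (sup_le hAB hsp)
      (fun U hU ↦ (h2 U hU).trans (sat_mono le_sup_left)) fun g hgB hg ↦ ?_)
  · refine lt_of_le_of_ne le_sup_left fun h ↦ heW.2.1 ?_
    rw [h]
    exact Ideal.mem_sup_right (Ideal.mem_span_singleton_self _)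
  · by_contra hgA
    rw [hA.monomial_mem_sup_span, not_or] at hgA
    have hgj : ∀ j ≠ i, monomial g (1 : K) ∈ sat {j} A := by
      intro j hj
      obtain ⟨N, hN⟩ := monomial_mem_sat.1 (hg j)
      rw [monomial_mem_sat]
      rcases hA.monomial_mem_sup_span.1 hN with h | h
      · exact ⟨N, h⟩
      · refine ⟨N + 1, monomial_mem_of_le ?_ (he j hj)⟩
        rw [add_smul, ← add_assoc, one_smul, ← one_smul ℕ (ind {j}), smul_ind_singleton 1]
        gcongr
        simpa [smul_ind_singleton] using h
    have hgi : monomial g (1 : K) ∉ sat {i} A := fun h ↦ hgA.1 (h1 g hgB fun j ↦ by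
      by_cases hj : j = i
      · exact hj ▸ h
      · exact hgj j hj)
    obtain ⟨N, hN⟩ := monomial_mem_sat.1 (hg i)
    rcases hA.monomial_mem_sup_span.1 hN with h | h
    · exact hgi (monomial_mem_sat.2 ⟨N, h⟩)
    have hgW : g ∈ W := ⟨hgB, hgA.1, hgj⟩
    have hgW' : g ∈ W' := by
      refine ⟨hgW, fun j hj ↦ h1 _ (monomial_mem_of_le le_self_add hgB) fun k ↦ ?_⟩
      by_cases hk : k = i
      · subst hk
        refine monomial_mem_sat.2 ⟨N, monomial_mem_of_le ?_ (he j hj)⟩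
        rw [add_right_comm]
        gcongr
      · exact monomial_mem_of_le le_self_add (hgj k hk)
    have hle := hmin hgW'
    obtain ⟨s, hs⟩ := le_iff_exists_add.1 h
    have hsj : ∀ j ≠ i, s j = 0 := by
      by_contra! hcon
      obtain ⟨j, hj, hsj⟩ := hcon
      refine hgi (monomial_mem_sat.2 ⟨N, ?_⟩)
      rw [hs, add_comm, hcol]
      exact ⟨j, Finset.mem_erase.2 ⟨hj, Finset.mem_univ j⟩, hsj⟩
    refine hgA.2 fun j ↦ ?_
    by_cases hj : j = i
    · subst hj
      by_contra hlt
      have := hle (by simpa using (not_le.1 hlt).le)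
      exact hlt this
    · have := DFunLike.congr_fun hs j
      simp [smul_ind_singleton, hsj j hj, Ne.symm hj] at this
      lia

lemma SuppClosed.satDim_three_eq {A : Ideal S} (hA : SuppClosed A) (h : A ≠ ⊥) :
    ∃ u : Fin 4 →₀ ℕ, PrettyClean.satDim 3 A = Ideal.span {monomial u 1} := by
  have hex : ∀ i, ∃ n, monomial (Finsupp.single i n) (1 : K) ∈
      PrettyClean.sat (Finset.univ.erase i) A := by
    intro i
    have h1 : (1 : S) ∈ PrettyClean.sat Finset.univ A := by rw [sat_univ_eq_top hA h]; trivial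
    obtain ⟨N, hN⟩ := monomial_mem_sat.1 h1
    refine ⟨N, monomial_mem_sat.2 ⟨N, monomial_mem_of_le (fun j ↦ ?_) hN⟩⟩
    by_cases hj : i = j
    · simp [hj, ind_apply]
    · simp [ind_apply, Ne.symm hj]
  classical
  refine ⟨Finsupp.equivFunOnFinite.symm fun i ↦ Nat.find (hex i),
    (hA.satDim 3).ext (suppClosed_span_singleton _) fun e ↦ ?_⟩
  rw [monomial_mem_span_singleton, mem_satDim]
  constructor
  · intro he i
    refine Nat.find_min' (hex i) (monomial_mem_sat_of_le (fun j hj ↦ ?_)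
      (he (Finset.univ.erase i) (by simp)))
    have : j = i := by simpa using hj
    simp [this]
  · intro he U hU
    obtain ⟨i, hi⟩ := Finset.card_eq_one.1 (show Uᶜ.card = 1 by
      rw [Finset.card_compl, hU]; rfl)
    have hU' : U = Finset.univ.erase i := by
      rw [← compl_compl U, hi, ← Finset.compl_singleton]
    subst hU'
    refine monomial_mem_sat_of_le (fun j hj ↦ ?_) (Nat.find_spec (hex i))
    have : j = i := by simpa using hj
    simpa [this] using he i

lemma varPrime_empty : varPrime K ∅ = ⊥ := by simp [varPrime]

/-- The pieces of dimension 0, 1 and 3 of the dimension filtration always have a filtration by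
prime quotients of the right dimension. -/
lemma filt_satDim {A : Ideal S} (hA : SuppClosed A) (h : A ≠ ⊥) {d : ℕ} (hd : d < 4) (h2 : d ≠ 2) :
    Filt d (satDim d A) (satDim (d + 1) A) := by
  have hle : satDim d A ≤ satDim (d + 1) A := satDim_le_satDim d.le_succ
  have hsat : ∀ U : Finset (Fin 4), U.card = d + 1 → satDim (d + 1) A ≤ sat U (satDim d A) :=
    fun U hU ↦ hU ▸ satDim_le_sat.trans (sat_mono le_satDim)
  interval_cases d
  · exact filt_zero (hA.satDim 0) (hA.satDim 1) hle fun j ↦ hsat {j} rfl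
  · refine filt_one (hA.satDim 1) (hA.satDim 2) hle hsat fun e _ he ↦ mem_satDim.2 fun U hU ↦ ?_
    obtain ⟨j, rfl⟩ := Finset.card_eq_one.1 hU
    have := sat_satDim (A := A) (U := {j})
    rw [Finset.card_singleton] at this
    exact this ▸ he j
  · exact absurd rfl h2
  · rw [satDim_four hA h]
    obtain ⟨u, hu⟩ := hA.satDim_three_eq h
    rw [hu]
    have := filt_varPrime_sup_span (K := K) (T := ∅) (d := 3) rfl u (by simp)
    rwa [varPrime_empty, bot_sup_eq] at this

end Filtration

section DimTwo

lemma eq_of_nodup_four {k l m j : Fin 4} (h : [k, l, m, j].Nodup) (i : Fin 4) :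
    i = k ∨ i = l ∨ i = m ∨ i = j := by
  revert k l m j i
  decide

lemma exists_nodup_four_of_three {a b c : Fin 4} (hab : a ≠ b) (hac : a ≠ c) (hbc : b ≠ c) :
    ∃ d, [a, b, c, d].Nodup := by
  revert a b c
  decide

/-- The combinatorial obstruction to `k` being removable, in terms of the exponents
`p k l` of `x_l` in the localizations at `(x_k, x_l)`. -/
def Obstructed (p : Fin 4 → Fin 4 → ℕ) (k l m j : Fin 4) : Prop :=
  p k l < p m l ∧ p k m < p l m ∧ (p k j ≤ p l j ∨ p k j ≤ p m j)

lemma lt_or_lt_of_obstructed {p : Fin 4 → Fin 4 → ℕ} {k l m j : Fin 4}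
    (hn : [k, l, m, j].Nodup) (hlt : p k m < p l m) {a b c : Fin 4} (hn' : [l, a, b, c].Nodup)
    (h : Obstructed p l a b c) : p l j < p k j ∨ p l j < p m j := by
  have hcov := eq_of_nodup_four hn
  simp only [List.nodup_cons, List.mem_cons, List.not_mem_nil, not_or, or_false,
    not_false_eq_true, List.nodup_nil, and_true] at hn hn'
  simp only [Obstructed] at h
  rcases hcov a with rfl | rfl | rfl | rfl <;> rcases hcov b with rfl | rfl | rfl | rfl <;>
    rcases hcov c with rfl | rfl | rfl | rfl <;> simp_all <;> lia

lemma exists_not_obstructed (p : Fin 4 → Fin 4 → ℕ) :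
    ∃ k, ∀ l m j, [k, l, m, j].Nodup → ¬ Obstructed p k l m j := by
  by_contra! hcon
  obtain ⟨l, m, j, hn, h0⟩ := hcon 0
  obtain ⟨a, b, c, hn1, h1⟩ := hcon l
  obtain ⟨a', b', c', hn2, h2⟩ := hcon m
  have hl := lt_or_lt_of_obstructed hn h0.2.1 hn1 h1
  have hm := lt_or_lt_of_obstructed (l := m) (m := l) (j := j) (k := 0)
    (by simp at hn ⊢; tauto) h0.1 hn2 h2
  have := h0.2.2
  lia

lemma compl_eq_pair {U : Finset (Fin 4)} (hU : U.card = 2) :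
    ∃ a b, a ≠ b ∧ U = {a, b}ᶜ := by
  obtain ⟨a, b, hab, h⟩ := Finset.card_eq_two.1 (show Uᶜ.card = 2 by
    rw [Finset.card_compl, hU]; rfl)
  exact ⟨a, b, hab, by rw [← h, compl_compl]⟩

lemma single_mem_sat_pair {J : Ideal S} {a b : Fin 4} (h : a ≠ b) {e : Fin 4 →₀ ℕ}
    (ha : e a = 0) :
    monomial e (1 : K) ∈ sat {a, b}ᶜ J ↔
      monomial (Finsupp.single b (e b)) (1 : K) ∈ sat {a, b}ᶜ J := by
  constructor <;> refine monomial_mem_sat_of_le fun i hi ↦ ?_ <;>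
  · have : i = a ∨ i = b := by simpa [or_iff_not_imp_left] using hi
    rcases this with rfl | rfl
    · simp [ha, h.symm]
    · simp

/-- An ideal has condition `C` if no monomial is in exactly all but two opposite ones of
its saturations with respect to two variables. -/
def CondC (J : Ideal (MvPolynomial (Fin 4) K)) : Prop :=
  ∀ a b c d, [a, b, c, d].Nodup → ∀ e, monomial e (1 : K) ∈ sat {a, c}ᶜ J →
    monomial e (1 : K) ∈ sat {a, d}ᶜ J → monomial e (1 : K) ∈ sat {b, c}ᶜ J →
    monomial e (1 : K) ∈ sat {b, d}ᶜ J →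
    monomial e (1 : K) ∈ sat {a, b}ᶜ J ∨ monomial e (1 : K) ∈ sat {c, d}ᶜ J

lemma monomial_mem_sat_colonBy {J : Ideal S} {U : Finset (Fin 4)} {e a : Fin 4 →₀ ℕ} :
    monomial e (1 : K) ∈ sat U (colonBy J (monomial a 1)) ↔
      monomial (e + a) (1 : K) ∈ sat U J := by
  rw [mem_sat_colonBy, monomial_mul, one_mul]

lemma CondC.colonBy {J : Ideal S} (h : CondC J) (u : Fin 4 →₀ ℕ) :
    CondC (colonBy J (monomial u 1)) := by
  intro a b c d hn e
  simp only [monomial_mem_sat_colonBy]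
  exact h a b c d hn _

lemma satDim_colonBy_le {J : Ideal S} {d : ℕ} (h : satDim d J ≤ J) (u : Fin 4 →₀ ℕ) :
    satDim d (colonBy J (monomial u 1)) ≤ colonBy J (monomial u 1) := by
  intro f hf
  rw [mem_colonBy]
  exact h (mem_satDim.2 fun U hU ↦ mem_sat_colonBy.1 (mem_satDim.1 hf U hU))

lemma exists_sat_pair_threshold {J : Ideal S}
    (h3 : ∀ U : Finset (Fin 4), U.card = 3 → sat U J = ⊤) :
    ∃ p : Fin 4 → Fin 4 → ℕ, ∀ k l e, k ≠ l → e k = 0 →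
      (monomial e (1 : K) ∈ sat {k, l}ᶜ J ↔ p k l ≤ e l) := by
  have hex : ∀ k l, ∃ t, k ≠ l → monomial (Finsupp.single l t) (1 : K) ∈ sat {k, l}ᶜ J := by
    intro k l
    have h1 : monomial 0 (1 : K) ∈ sat {k}ᶜ J := by
      rw [h3 _ (by rw [Finset.card_compl]; rfl)]
      trivial
    obtain ⟨N, hN⟩ := monomial_mem_sat.1 h1
    refine ⟨N, fun hkl ↦ monomial_mem_sat_of_le (fun i hi ↦ ?_) (le_sat hN)⟩
    have : i = k ∨ i = l := by simpa [or_iff_not_imp_left] using hi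
    rcases this with rfl | rfl
    · simp [ind_apply]
    · simp [ind_apply, hkl.symm]
  classical
  refine ⟨fun k l ↦ Nat.find (hex k l), fun k l e hkl hek ↦ ?_⟩
  rw [single_mem_sat_pair hkl hek]
  refine ⟨fun h ↦ Nat.find_min' (hex k l) fun _ ↦ h, fun h ↦ ?_⟩
  exact monomial_mem_sat_of_le (fun i _ ↦ Finsupp.single_le_single.2 h i)
    (Nat.find_spec (hex k l) hkl)

lemma filt_two_top {J : Ideal S} (hJ : SuppClosed J) (h2 : satDim 2 J ≤ J)
    (h3 : ∀ U : Finset (Fin 4), U.card = 3 → sat U J = ⊤) (hC : CondC J) : Filt 2 J ⊤ := by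
  induction J using WellFoundedGT.induction with
  | ind J ih =>
  by_cases hJT : J = ⊤
  · rw [hJT]
    exact .refl _
  have h2' : ∀ e, (∀ a b, a ≠ b → monomial e (1 : K) ∈ sat {a, b}ᶜ J) →
      monomial e (1 : K) ∈ J := fun e he ↦ h2 (mem_satDim.2 fun U hU ↦ by
    obtain ⟨a, b, hab, rfl⟩ := compl_eq_pair hU
    exact he a b hab)
  obtain ⟨p, hp⟩ := exists_sat_pair_threshold h3
  have hp' : ∀ {k l e}, k ≠ l → p k l ≤ e l → monomial e (1 : K) ∈ sat {k, l}ᶜ J := by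
    intro k l e hkl h
    refine monomial_mem_sat_of_le (fun i _ ↦ ?_) ((hp k l (e.erase k) hkl (by simp)).2
      (by simpa [hkl.symm] using h))
    by_cases hi : i = k <;> simp [hi]
  obtain ⟨k, hk⟩ := exists_not_obstructed p
  have hgood : ∀ l m j, [k, l, m, j].Nodup → ∀ e, p k l ≤ e l → p k m ≤ e m →
      monomial e (1 : K) ∈ sat {l, m}ᶜ J := by
    intro l m j hn e hl hm
    by_contra he
    have hn' := hn
    simp only [List.nodup_cons, List.mem_cons, List.not_mem_nil, not_or, or_false,
      not_false_eq_true, List.nodup_nil, and_true] at hn'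
    obtain ⟨⟨hkl, hkm, hkj⟩, ⟨hlm, hlj⟩, hmj⟩ := hn'
    refine hk l m j hn ⟨?_, ?_, ?_⟩
    · by_contra! h
      exact he (Finset.pair_comm m l ▸ hp' (Ne.symm hlm) (h.trans hl))
    · by_contra! h
      exact he (hp' hlm (h.trans hm))
    · by_contra! h
      set c := max (p l j) (p m j) with hc
      set e' := Finsupp.single l (e l) + Finsupp.single m (e m) + Finsupp.single j c with he'
      have hel : e' l = e l := by simp [he', hlm, hlj]
      have hem : e' m = e m := by simp [he', hlm, Ne.symm hmj]
      have hej : e' j = c := by simp [he', hlj, hmj]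
      have hek : e' k = 0 := by simp [he', hkl, hkm, hkj]
      rcases hC l m k j (by simp; tauto) e' (Finset.pair_comm k l ▸ hp' hkl (by lia))
        (hp' hlj (by lia)) (Finset.pair_comm k m ▸ hp' hkm (by lia)) (hp' hmj (by lia)) with h' | h'
      · refine he (monomial_mem_sat_of_le (fun i hi ↦ ?_) h')
        have : i = l ∨ i = m := by simpa [or_iff_not_imp_left] using hi
        rcases this with rfl | rfl
        · exact hel.le
        · exact hem.le
      · have := (hp k j e' hkj hek).1 h'
        lia
  obtain ⟨v, hvk, hv⟩ : ∃ v : Fin 4 →₀ ℕ, v k = 0 ∧ ∀ i ≠ k, v i = p k i :=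
    ⟨Finsupp.equivFunOnFinite.symm fun i ↦ if i = k then 0 else p k i, by simp,
      fun i hi ↦ by simp [hi]⟩
  have hvJ : monomial v (1 : K) ∈ J := by
    refine h2' v fun a b hab ↦ ?_
    by_cases ha : a = k
    · subst ha
      exact hp' hab (hv b hab.symm).ge
    by_cases hb : b = k
    · subst hb
      exact Finset.pair_comm b a ▸ hp' hab.symm (hv a hab).ge
    obtain ⟨j, hj⟩ := exists_nodup_four_of_three (Ne.symm ha) (Ne.symm hb) hab
    exact hgood a b j hj v (hv a ha).ge (hv b hb).ge
  have hsup : J ⊔ Ideal.span {monomial (Finsupp.single k 1) 1} =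
      varPrime K {k} ⊔ Ideal.span {monomial v 1} := by
    refine (hJ.sup (suppClosed_span_singleton _)).ext
      ((suppClosed_varPrime _).sup (suppClosed_span_singleton _)) fun e ↦ ?_
    rw [hJ.monomial_mem_sup_span, (suppClosed_varPrime _).monomial_mem_sup_span,
      monomial_mem_varPrime]
    by_cases hek : e k = 0
    · have h1 : ¬ Finsupp.single k 1 ≤ e := fun h ↦ by simpa [hek] using h k
      simp only [h1, or_false, Finset.mem_singleton, exists_eq_left, hek, ne_eq, not_true,
        false_or]
      refine ⟨fun he i ↦ ?_, fun h ↦ monomial_mem_of_le h hvJ⟩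
      by_cases hi : i = k
      · simp [hi, hvk]
      · rw [hv i hi]
        exact (hp k i e (Ne.symm hi) hek).1 (le_sat he)
    · have h1 : Finsupp.single k 1 ≤ e := by
        simp
        lia
      simp [h1, hek]
  have hlt : J < colonBy J (monomial (Finsupp.single k 1) 1) := by
    refine lt_of_le_of_ne (fun f hf ↦ J.mul_mem_right _ hf) fun heq ↦ hJT ?_
    have hreg : ∀ e n, monomial (e + Finsupp.single k n) (1 : K) ∈ J → monomial e (1 : K) ∈ J := by
      intro e n
      induction n with
      | zero => simp
      | succ n ih =>
        intro h
        refine ih ?_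
        rw [heq, monomial_mem_colonBy, add_assoc, ← Finsupp.single_add]
        exact h
    have hv0 : v = 0 := by
      ext i
      by_cases hi : i = k
      · simp [hi, hvk]
      have h1 : monomial 0 (1 : K) ∈ sat {i}ᶜ J := by
        rw [h3 _ (by rw [Finset.card_compl]; rfl)]
        trivial
      obtain ⟨N, hN⟩ := monomial_mem_sat.1 h1
      have h4 : monomial 0 (1 : K) ∈ sat {k, i}ᶜ J := by
        refine monomial_mem_sat.2 ⟨N, hreg _ N (monomial_mem_of_le (fun j ↦ ?_) hN)⟩
        by_cases hji : j = i
        · simp [hji, ind_apply]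
        · by_cases hjk : j = k
          · simp [hjk, ind_apply, Ne.symm hi]
          · simp [hji, hjk, ind_apply]
      rw [hv i hi]
      simpa using (hp k i 0 (Ne.symm hi) rfl).1 h4
    rw [hv0] at hvJ
    exact J.eq_top_iff_one.2 hvJ
  have hstep := Filt.of_colonBy (ih _ hlt (hJ.colonBy _) (satDim_colonBy_le h2 _)
    (fun U hU ↦ ?_) (hC.colonBy _))
  · rw [hsup] at hstep
    exact hstep.trans (filt_varPrime_sup_span (by simp) v (by simpa using hvk))
  · rw [eq_top_iff, ← h3 U hU]
    exact sat_mono hlt.le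

end DimTwo

section RegPair

/-- `f, g` is a weakly regular sequence on `B / A`. -/
def RegPair {R : Type*} [CommRing R] (f g : R) (A B : Ideal R) : Prop :=
  (∀ s ∈ B, f * s ∈ A → s ∈ A) ∧
    ∀ b ∈ B, (∃ t ∈ B, g * b - f * t ∈ A) → ∃ t ∈ B, b - f * t ∈ A

lemma RegPair.of_le {R : Type*} [CommRing R] {f g : R} {A B C : Ideal R} (h : RegPair f g A B)
    (hAC : A ≤ C) (hCB : C ≤ B) (hf : ∀ t ∈ B, f * t ∈ C → t ∈ C) : RegPair f g A C := by
  refine ⟨fun s hs ↦ h.1 s (hCB hs), fun b hb ⟨t, ht, hbt⟩ ↦ ?_⟩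
  obtain ⟨t', ht', hb'⟩ := h.2 b (hCB hb) ⟨t, hCB ht, hbt⟩
  refine ⟨t', hf _ ht' ?_, hb'⟩
  have := C.sub_mem hb (hAC hb')
  rwa [sub_sub_cancel] at this

lemma RegPair.mem_sat {f g : S} {A B : Ideal S} (h : RegPair f g A B) {t : S} (ht : t ∈ B)
    {U : Finset (Fin 4)} (hft : f * t ∈ sat U A) : t ∈ sat U A := by
  obtain ⟨N, hN⟩ := hft
  exact ⟨N, h.1 _ (B.mul_mem_right _ ht) (by rwa [← mul_assoc])⟩

lemma le_sup_of_regPair {f g : S} {A B C : Ideal S} (hC : SuppClosed C)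
    (hBC : B ≤ C) (hf : f ∈ varPrime K Finset.univ)
    (hg : g ∈ varPrime K Finset.univ) (h : RegPair f g (A ⊓ B) C)
    (hfA : ∀ t ∈ C, f * t ∈ A → t ∈ A) (hfB : ∀ t ∈ C, f * t ∈ B → t ∈ B)
    (hN : ∀ e, monomial e (1 : K) ∈ C → ∀ j, ∃ N,
      monomial (e + Finsupp.single j N) (1 : K) ∈ A ⊔ B) :
    C ≤ A ⊔ B := by
  rw [hC.le_iff]
  intro e₀ he₀
  by_contra hcon
  obtain ⟨e, ⟨heC, he⟩, hX⟩ := exists_colon_single (A ⊔ B) Finset.univ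
    {e | monomial e (1 : K) ∈ C ∧ monomial e (1 : K) ∉ A ⊔ B} ⟨e₀, he₀, hcon⟩ (fun e he ↦ he.2)
    (fun e he i _ hi ↦ ⟨monomial_mem_of_le le_self_add he.1, hi⟩)
    (fun e he i _ ↦ hN e he.1 i)
  have hm : ∀ p ∈ varPrime K Finset.univ, p * monomial e 1 ∈ A ⊔ B := by
    intro p hp
    have : varPrime K Finset.univ ≤ colonBy (A ⊔ B) (monomial e 1) := by
      rw [varPrime_le_iff]
      intro i hi
      rw [mem_colonBy, X, monomial_mul, one_mul, add_comm]
      exact hX i hi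
    exact this hp
  obtain ⟨a, ha, b, hb, hab⟩ := Submodule.mem_sup.1 (hm f hf)
  obtain ⟨a', ha', b', hb', hab'⟩ := Submodule.mem_sup.1 (hm g hg)
  have hkey : g * b - f * b' = f * a' - g * a := by
    linear_combination g * hab - f * hab'
  obtain ⟨t, ht, hbt⟩ := h.2 b (hBC hb) ⟨b', hBC hb', by
    rw [hkey]
    exact A.sub_mem (A.mul_mem_left _ ha') (A.mul_mem_left _ ha), by
    exact B.sub_mem (B.mul_mem_left _ hb) (B.mul_mem_left _ hb')⟩
  have htB : t ∈ B := hfB t ht (by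
    have := B.sub_mem hb hbt.2
    rwa [sub_sub_cancel] at this)
  have hcA : monomial e 1 - t ∈ A := by
    refine hfA _ (C.sub_mem heC ht) ?_
    have := A.add_mem ha hbt.1
    rwa [← add_sub_assoc, hab, ← mul_sub] at this
  have := (A ⊔ B).add_mem (Ideal.mem_sup_left hcA) (Ideal.mem_sup_right htB)
  rw [sub_add_cancel] at this
  exact he this

lemma exists_monomial_mem_sat_of_insert {A : Ideal S} {U V : Finset (Fin 4)} {j : Fin 4}
    (hV : V ⊆ insert j U) {e : Fin 4 →₀ ℕ} (he : monomial e (1 : K) ∈ sat V A) :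
    ∃ N, monomial (e + Finsupp.single j N) (1 : K) ∈ sat U A := by
  obtain ⟨N, hN⟩ := monomial_mem_sat.1 he
  refine ⟨N, monomial_mem_sat.2 ⟨N, monomial_mem_of_le (fun i ↦ ?_) hN⟩⟩
  simp only [Finsupp.add_apply, Finsupp.smul_apply, ind_apply, smul_eq_mul]
  by_cases hi : i ∈ V
  · rcases Finset.mem_insert.1 (hV hi) with rfl | hU
    · simp [hi]
    · simp [hi, hU]
  · simp [hi]
    lia

lemma forall_pair_of_nodup_four {a b c d : Fin 4} (hn : [a, b, c, d].Nodup)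
    {p : Fin 4 → Fin 4 → Prop} (hp : ∀ k l, p k l → p l k) (hab : p a b) (hac : p a c)
    (had : p a d) (hbc : p b c) (hbd : p b d) (hcd : p c d) {k l : Fin 4} (h : k ≠ l) : p k l := by
  rcases eq_of_nodup_four hn k with rfl | rfl | rfl | rfl <;>
  rcases eq_of_nodup_four hn l with rfl | rfl | rfl | rfl <;>
  first
  | exact absurd rfl h
  | assumption
  | (apply hp; assumption)

lemma condC_colonBy_of_regPair {f g : S} {D C : Ideal S} (hD : SuppClosed D) (hC : SuppClosed C)
    (hDC : D ≤ C) (h2 : satDim 2 D ≤ D)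
    (h3 : ∀ U : Finset (Fin 4), U.card = 3 → C ≤ sat U D) (hf : f ∈ varPrime K Finset.univ)
    (hg : g ∈ varPrime K Finset.univ) (h : RegPair f g D C) {u : Fin 4 →₀ ℕ}
    (hu : monomial u (1 : K) ∈ C) : CondC (colonBy D (monomial u 1)) := by
  intro a b c d hn e h1 h2' h3' h4
  simp only [monomial_mem_sat_colonBy] at *
  set C' : Ideal S := C ⊓ (sat {a, c}ᶜ D ⊓ (sat {a, d}ᶜ D ⊓ (sat {b, c}ᶜ D ⊓ sat {b, d}ᶜ D)))
    with hC'
  have hC's : SuppClosed C' := hC.inf ((hD.sat _).inf ((hD.sat _).inf ((hD.sat _).inf (hD.sat _))))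
  have hDC' : D ≤ C' := le_inf hDC (le_inf le_sat (le_inf le_sat (le_inf le_sat le_sat)))
  have hinf : C' ⊓ sat {a, b}ᶜ D ⊓ (C' ⊓ sat {c, d}ᶜ D) = D := by
    refine le_antisymm (fun x hx ↦ h2 (mem_satDim.2 fun U hU ↦ ?_))
      (le_inf (le_inf hDC' le_sat) (le_inf hDC' le_sat))
    obtain ⟨k, l, hkl, rfl⟩ := compl_eq_pair hU
    obtain ⟨⟨⟨-, x1, x2, x3, x4⟩, x5⟩, -, x6⟩ := hx
    exact forall_pair_of_nodup_four hn (p := fun k l ↦ x ∈ sat {k, l}ᶜ D)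
      (fun k l h ↦ Finset.pair_comm l k ▸ h) x5 x1 x2 x3 x4 x6 hkl
  have hreg : ∀ U, ∀ t ∈ C', f * t ∈ C' ⊓ sat U D → t ∈ C' ⊓ sat U D :=
    fun U t ht hft ↦ ⟨ht, h.mem_sat ht.1 hft.2⟩
  have hRP : RegPair f g D C' := h.of_le hDC' inf_le_left fun t ht ⟨_, t1, t2, t3, t4⟩ ↦
    ⟨ht, h.mem_sat ht t1, h.mem_sat ht t2, h.mem_sat ht t3, h.mem_sat ht t4⟩
  have hle := le_sup_of_regPair (A := C' ⊓ sat {a, b}ᶜ D) (B := C' ⊓ sat {c, d}ᶜ D) hC's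
    inf_le_left hf hg (hinf.symm ▸ hRP) (hreg _) (hreg _) fun e he j ↦ by
      have key : ∀ k l, k ≠ l → (j = k ∨ j = l) → ∃ N, monomial (e + Finsupp.single j N) (1 : K) ∈
          C' ⊓ sat {k, l}ᶜ D := by
        intro k l hkl hj
        obtain ⟨N, hN⟩ := exists_monomial_mem_sat_of_insert (j := j) (U := {k, l}ᶜ) le_rfl
          (h3 (insert j {k, l}ᶜ) (by
            rw [Finset.card_insert_of_notMem (by simpa [or_iff_not_imp_left] using hj),
              Finset.card_compl, Finset.card_pair hkl]
            rfl) he.1)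
        exact ⟨N, monomial_mem_of_le le_self_add he, hN⟩
      simp only [List.nodup_cons, List.mem_cons, List.not_mem_nil, not_or, or_false,
        not_false_eq_true, List.nodup_nil, and_true] at hn
      rcases eq_of_nodup_four (k := a) (l := b) (m := c) (j := d) (by simp; tauto) j
        with hj | hj | hj | hj
      · exact (key a b hn.1.1 (.inl hj)).imp fun N ↦ Ideal.mem_sup_left
      · exact (key a b hn.1.1 (.inr hj)).imp fun N ↦ Ideal.mem_sup_left
      · exact (key c d hn.2.2 (.inl hj)).imp fun N ↦ Ideal.mem_sup_right
      · exact (key c d hn.2.2 (.inr hj)).imp fun N ↦ Ideal.mem_sup_right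
  have hmem := hle (show monomial (e + u) (1 : K) ∈ C' from
    ⟨monomial_mem_of_le le_add_self hu, h1, h2', h3', h4⟩)
  rw [(hC's.inf (hD.sat {a, b}ᶜ)).monomial_mem_sup (hC's.inf (hD.sat {c, d}ᶜ))] at hmem
  exact hmem.imp And.right And.right

lemma filt_two_of_regPair {f g : S} {I : Ideal S} (hI : SuppClosed I) (h0 : I ≠ ⊥)
    (hf : f ∈ varPrime K Finset.univ) (hg : g ∈ varPrime K Finset.univ)
    (h : RegPair f g (satDim 2 I) (satDim 3 I)) : Filt 2 (satDim 2 I) (satDim 3 I) := by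
  have h2 : satDim 2 (satDim 2 I) ≤ satDim 2 I := fun x hx ↦ mem_satDim.2 fun U hU ↦ by
    have := mem_satDim.1 hx U hU
    rwa [← hU, sat_satDim] at this
  have h3 : ∀ U : Finset (Fin 4), U.card = 3 → satDim 3 I ≤ sat U (satDim 2 I) :=
    fun U hU ↦ (hU ▸ satDim_le_sat).trans (sat_mono le_satDim)
  obtain ⟨u, hu⟩ := hI.satDim_three_eq h0
  have hu3 : monomial u (1 : K) ∈ satDim 3 I := hu ▸ Ideal.mem_span_singleton_self _
  have := Filt.of_colonBy (filt_two_top ((hI.satDim 2).colonBy u) (satDim_colonBy_le h2 u)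
    (fun U hU ↦ eq_top_iff.2 fun x _ ↦ mem_sat_colonBy.2 (Ideal.mul_mem_left _ _ (h3 U hU hu3)))
    (condC_colonBy_of_regPair (hI.satDim 2) (hI.satDim 3) (satDim_le_satDim (by simp)) h2 h3 hf hg
      h hu3))
  rwa [← hu, sup_eq_right.2 (satDim_le_satDim (by simp))] at this

end RegPair

section Sigma

variable (K) in
/-- The elementary symmetric polynomial of degree one. -/
noncomputable def sigma₁ : S := ∑ i, X i

variable (K) in
/-- The elementary symmetric polynomial of degree two. -/
noncomputable def sigma₂ : S :=
  X 0 * X 1 + X 0 * X 2 + X 0 * X 3 + X 1 * X 2 + X 1 * X 3 + X 2 * X 3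

variable (K) in
/-- The elementary symmetric polynomial of degree three. -/
noncomputable def sigma₃ : S :=
  X 0 * X 1 * X 2 + X 0 * X 1 * X 3 + X 0 * X 2 * X 3 + X 1 * X 2 * X 3

lemma X_mem_varPrime_univ (i : Fin 4) : (X i : S) ∈ varPrime K Finset.univ :=
  X_mem_varPrime.2 (Finset.mem_univ i)

lemma sigma₁_mem : sigma₁ K ∈ varPrime K Finset.univ :=
  Ideal.sum_mem _ fun i _ ↦ X_mem_varPrime_univ i

lemma sigma₂_mem : sigma₂ K ∈ varPrime K Finset.univ := by
  have (i j : Fin 4) : (X i * X j : S) ∈ varPrime K Finset.univ :=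
    Ideal.mul_mem_right _ _ (X_mem_varPrime_univ i)
  iterate 5 refine Ideal.add_mem _ ?_ (this _ _)
  exact this _ _

lemma sigma₃_mem : sigma₃ K ∈ varPrime K Finset.univ := by
  have (i j k : Fin 4) : (X i * X j * X k : S) ∈ varPrime K Finset.univ :=
    Ideal.mul_mem_right _ _ (Ideal.mul_mem_right _ _ (X_mem_varPrime_univ i))
  iterate 3 refine Ideal.add_mem _ ?_ (this _ _ _)
  exact this _ _ _

lemma X_pow_four (j : Fin 4) : (X j : S) ^ 4 =
    sigma₁ K * X j ^ 3 - sigma₂ K * X j ^ 2 + sigma₃ K * X j - X 0 * X 1 * X 2 * X 3 := by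
  fin_cases j <;> simp [sigma₁, sigma₂, sigma₃, Fin.sum_univ_four] <;> ring

lemma eval_eq_zero_of_mem_varPrime {T : Finset (Fin 4)} {x : Fin 4 → K} (hx : ∀ i ∈ T, x i = 0)
    {f : S} (hf : f ∈ varPrime K T) : eval x f = 0 := by
  have : varPrime K T ≤ RingHom.ker (eval x) := by
    rw [varPrime_le_iff]
    intro i hi
    simp [hx i hi]
  exact this hf

lemma sigma₁_notMem {T : Finset (Fin 4)} {i : Fin 4} (hi : i ∉ T) : sigma₁ K ∉ varPrime K T := by
  intro h
  have := eval_eq_zero_of_mem_varPrime (x := Pi.single i 1) (fun j hj ↦ by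
    simp [ne_of_mem_of_not_mem hj hi]) h
  simp [sigma₁, Pi.single_apply] at this

lemma isPrime_varPrime_sup_sigma₁ {T : Finset (Fin 4)} {i : Fin 4} (hi : i ∉ T) :
    (varPrime K T ⊔ Ideal.span {sigma₁ K}).IsPrime := by
  classical
  set v : Fin 4 → S := fun j ↦ if j ∈ T then 0 else X j with hv
  have hvX : ∀ j, X j - v j ∈ varPrime K T := by
    intro j
    by_cases hj : j ∈ T <;> simp [hv, hj, X_mem_varPrime]
  set φ : S →ₐ[K] S := aeval fun j ↦ if j = i then -∑ k ∈ Finset.univ.erase i, v k else v j with hφ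
  have hker : RingHom.ker φ = varPrime K T ⊔ Ideal.span {sigma₁ K} := by
    refine ker_eq_of_section φ (AlgHom.id K S) _ (fun j ↦ ?_) fun f hf ↦ ?_
    · by_cases hj : j = i
      · subst hj
        have : X j - φ (X j) = sigma₁ K - ∑ k ∈ Finset.univ.erase j, (X k - v k) := by
          rw [sigma₁, ← Finset.add_sum_erase _ _ (Finset.mem_univ j), Finset.sum_sub_distrib]
          simp only [hφ, aeval_X, if_true]
          ring
        rw [AlgHom.id_apply, this]
        exact Ideal.sub_mem _ (Ideal.mem_sup_right (Ideal.mem_span_singleton_self _))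
          (Ideal.mem_sup_left (Ideal.sum_mem _ fun k _ ↦ hvX k))
      · simpa [hφ, hj] using Ideal.mem_sup_left (hvX j)
    · have : varPrime K T ⊔ Ideal.span {sigma₁ K} ≤ RingHom.ker φ := by
        rw [sup_le_iff, varPrime_le_iff, Ideal.span_singleton_le_iff_mem]
        constructor
        · intro j hj
          simp [hφ, hv, hj, ne_of_mem_of_not_mem hj hi]
        · rw [RingHom.mem_ker, sigma₁, map_sum, ← Finset.add_sum_erase _ _ (Finset.mem_univ i),
            Finset.sum_congr (g := v) rfl fun k hk ↦ by simp [hφ, Finset.ne_of_mem_erase hk]]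
          simp [hφ]
      exact this hf
  rw [← hker]
  exact RingHom.ker_isPrime _

lemma eval_sigma₂ {i j : Fin 4} (hij : i ≠ j) :
    eval (Pi.single i 1 - Pi.single j 1) (sigma₂ K) = -1 := by
  fin_cases i <;> fin_cases j <;> simp [sigma₂] at hij ⊢

lemma sigma₂_notMem {T : Finset (Fin 4)} {i j : Fin 4} (hi : i ∉ T) (hj : j ∉ T) (hij : i ≠ j) :
    sigma₂ K ∉ varPrime K T ⊔ Ideal.span {sigma₁ K} := by
  intro h
  obtain ⟨p, hp, q, hq, hpq⟩ := Submodule.mem_sup.1 h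
  obtain ⟨r, rfl⟩ := Ideal.mem_span_singleton.1 hq
  have h1 := congrArg (eval (Pi.single i 1 - Pi.single j 1 : Fin 4 → K)) hpq
  rw [eval_sigma₂ hij, map_add, map_mul, eval_eq_zero_of_mem_varPrime (fun k hk ↦ by
    simp [ne_of_mem_of_not_mem hk hi, ne_of_mem_of_not_mem hk hj]) hp] at h1
  simp [sigma₁, Pi.single_apply] at h1

lemma exists_pair_notMem {T : Finset (Fin 4)} (hT : T.card ≤ 2) :
    ∃ i j, i ∉ T ∧ j ∉ T ∧ i ≠ j := by
  have : 1 < Tᶜ.card := by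
    rw [Finset.card_compl, Fintype.card_fin]
    lia
  obtain ⟨i, hi, j, hj, hij⟩ := Finset.one_lt_card.1 this
  exact ⟨i, j, by simpa using hi, by simpa using hj, hij⟩

lemma mem_of_sigma₂_mul_mem {T : Finset (Fin 4)} (hT : T.card ≤ 2) {s : S}
    (hs : sigma₂ K * s ∈ varPrime K T ⊔ Ideal.span {sigma₁ K}) :
    s ∈ varPrime K T ⊔ Ideal.span {sigma₁ K} := by
  obtain ⟨i, j, hi, hj, hij⟩ := exists_pair_notMem hT
  exact ((isPrime_varPrime_sup_sigma₁ hi).mem_or_mem hs).resolve_left (sigma₂_notMem hi hj hij)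

lemma mem_of_sigma₁_mul_mem {T : Finset (Fin 4)} (hT : T.card ≤ 3) {s : S}
    (hs : sigma₁ K * s ∈ varPrime K T) : s ∈ varPrime K T := by
  obtain ⟨i, hi⟩ : ∃ i, i ∉ T := by
    by_contra! h
    rw [Finset.eq_univ_iff_forall.2 h, Finset.card_univ, Fintype.card_fin] at hT
    lia
  exact ((isPrime_varPrime T).mem_or_mem hs).resolve_left (sigma₁_notMem hi)

lemma mem_sup_span_singleton {R : Type*} [CommRing R] {A : Ideal R} {f b : R} :
    b ∈ A ⊔ Ideal.span {f} ↔ ∃ t, b - f * t ∈ A := by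
  rw [Submodule.mem_sup]
  constructor
  · rintro ⟨p, hp, q, hq, rfl⟩
    obtain ⟨t, rfl⟩ := Ideal.mem_span_singleton.1 hq
    exact ⟨t, by simpa⟩
  · rintro ⟨t, ht⟩
    exact ⟨_, ht, f * t, Ideal.mul_mem_right _ _ (Ideal.mem_span_singleton_self _), by ring⟩

lemma regPair_varPrime {T : Finset (Fin 4)} (hT : T.card ≤ 2) :
    RegPair (sigma₁ K) (sigma₂ K) (varPrime K T) ⊤ := by
  refine ⟨fun s _ hs ↦ mem_of_sigma₁_mul_mem (by lia) hs, fun b _ ⟨t, _, hbt⟩ ↦ ?_⟩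
  have := mem_of_sigma₂_mul_mem hT (mem_sup_span_singleton.2 ⟨t, hbt⟩)
  obtain ⟨t, ht⟩ := mem_sup_span_singleton.1 this
  exact ⟨t, trivial, ht⟩

lemma varPrime_insert (T : Finset (Fin 4)) (j : Fin 4) :
    varPrime K (insert j T) = varPrime K T ⊔ Ideal.span {X j} := by
  rw [varPrime, varPrime, Finset.coe_insert, Set.image_insert_eq, Ideal.span_insert, sup_comm]

lemma mem_of_X_mul_mem {T : Finset (Fin 4)} (hT : T.card ≤ 1) {j : Fin 4} (hj : j ∉ T) {s : S}
    (hs : X j * s ∈ varPrime K T ⊔ Ideal.span {sigma₁ K} ⊔ Ideal.span {sigma₂ K}) :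
    s ∈ varPrime K T ⊔ Ideal.span {sigma₁ K} ⊔ Ideal.span {sigma₂ K} := by
  have hT' : (insert j T).card ≤ 2 := (Finset.card_insert_le _ _).trans (by lia)
  obtain ⟨c, hc⟩ := mem_sup_span_singleton.1 hs
  obtain ⟨b, hb⟩ := mem_sup_span_singleton.1 hc
  have hc' : c ∈ varPrime K (insert j T) ⊔ Ideal.span {sigma₁ K} := by
    refine mem_of_sigma₂_mul_mem hT' (mem_sup_span_singleton.2 ⟨-b, ?_⟩)
    rw [varPrime_insert]
    exact mem_sup_span_singleton.2 ⟨s, by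
      convert! (varPrime K T).neg_mem hb using 1
      ring⟩
  obtain ⟨r, hr⟩ := mem_sup_span_singleton.1 hc'
  rw [varPrime_insert] at hr
  obtain ⟨q, hq⟩ := mem_sup_span_singleton.1 hr
  have hb' : b + sigma₂ K * r ∈ varPrime K (insert j T) := by
    refine mem_of_sigma₁_mul_mem (by lia) ?_
    rw [varPrime_insert]
    refine mem_sup_span_singleton.2 ⟨s - sigma₂ K * q, ?_⟩
    convert! (varPrime K T).neg_mem
      ((varPrime K T).add_mem hb ((varPrime K T).mul_mem_left (sigma₂ K) hq)) using 1
    ring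
  rw [varPrime_insert] at hb'
  obtain ⟨q', hq'⟩ := mem_sup_span_singleton.1 hb'
  refine mem_sup_span_singleton.2 ⟨q, mem_sup_span_singleton.2 ⟨q', ?_⟩⟩
  refine ((isPrime_varPrime T).mem_or_mem (x := X j) ?_).resolve_left
    (fun h ↦ hj (X_mem_varPrime.1 h))
  convert! (varPrime K T).add_mem ((varPrime K T).add_mem hb
    ((varPrime K T).mul_mem_left (sigma₂ K) hq)) ((varPrime K T).mul_mem_left (sigma₁ K) hq')
    using 1
  ring

lemma mem_of_sigma₃_mul_mem {T : Finset (Fin 4)} (hT : T.card = 1) {s : S}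
    (hs : sigma₃ K * s ∈ varPrime K T ⊔ Ideal.span {sigma₁ K} ⊔ Ideal.span {sigma₂ K}) :
    s ∈ varPrime K T ⊔ Ideal.span {sigma₁ K} ⊔ Ideal.span {sigma₂ K} := by
  obtain ⟨j, -, hj, -⟩ := exists_pair_notMem (hT.le.trans one_le_two)
  obtain ⟨t, rfl⟩ := Finset.card_eq_one.1 hT
  set A : Ideal S := varPrime K {t} ⊔ Ideal.span {sigma₁ K} ⊔ Ideal.span {sigma₂ K} with hA
  have h1 : sigma₁ K ∈ A :=
    Ideal.mem_sup_left (Ideal.mem_sup_right (Ideal.mem_span_singleton_self _))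
  have h2 : sigma₂ K ∈ A := Ideal.mem_sup_right (Ideal.mem_span_singleton_self _)
  have h4 : (X 0 * X 1 * X 2 * X 3 : S) ∈ A := by
    have ht : (X t : S) ∈ A :=
      Ideal.mem_sup_left (Ideal.mem_sup_left (X_mem_varPrime.2 (Finset.mem_singleton_self t)))
    rw [← Fin.prod_univ_four (fun i ↦ (X i : S))]
    exact A.mem_of_dvd (Finset.dvd_prod_of_mem _ (Finset.mem_univ t)) ht
  have hX : (X j : S) ^ 4 * s ∈ A := by
    rw [X_pow_four]
    have : (sigma₁ K * X j ^ 3 - sigma₂ K * X j ^ 2 + sigma₃ K * X j - X 0 * X 1 * X 2 * X 3) * s =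
        sigma₁ K * (X j ^ 3 * s) - sigma₂ K * (X j ^ 2 * s) + (sigma₃ K * s) * X j -
          X 0 * X 1 * X 2 * X 3 * s := by ring
    rw [this]
    exact A.sub_mem (A.add_mem (A.sub_mem (A.mul_mem_right _ h1) (A.mul_mem_right _ h2))
      (A.mul_mem_right _ hs)) (A.mul_mem_right _ h4)
  have key {x : S} (hx : X j * x ∈ A) : x ∈ A := mem_of_X_mul_mem hT.le ‹_› hx
  refine key (key (key (key ?_)))
  convert! hX using 1
  ring

end Sigma

section Depth

open RingTheory.Sequence Module

variable {R M M₁ M₂ : Type*} [CommRing R] [AddCommGroup M] [AddCommGroup M₁] [AddCommGroup M₂]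
  [Module R M] [Module R M₁] [Module R M₂]

lemma isWeaklyRegular_of_exact {f : M₁ →ₗ[R] M} {g : M →ₗ[R] M₂} (hf : Function.Injective f)
    (hfg : Function.Exact f g) (hg : Function.Surjective g) {rs : List R}
    (h₁ : IsWeaklyRegular M₁ rs) (h₂ : IsWeaklyRegular M₂ rs) : IsWeaklyRegular M rs := by
  induction rs generalizing M M₁ M₂ with
  | nil => exact .nil R M
  | cons r rs ih =>
    rw [isWeaklyRegular_cons_iff] at *
    refine ⟨isSMulRegular_of_range_eq_ker hf hfg.linearMap_ker_eq.symm h₁.1 h₂.1, ?_⟩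
    refine ih (f := QuotSMulTop.map r f) (g := QuotSMulTop.map r g) ?_
      (QuotSMulTop.map_exact r hfg hg) (QuotSMulTop.map_surjective r hg) h₁.2 h₂.2
    have h0 : Function.Exact (0 : M₁ →ₗ[R] M₁) f := by
      rw [LinearMap.exact_iff, LinearMap.range_zero, LinearMap.ker_eq_bot.2 hf]
    have := QuotSMulTop.map_first_exact_on_four_term_exact_of_isSMulRegular_last h0 hfg h₂.1
    rw [map_zero, LinearMap.exact_iff, LinearMap.range_zero] at this
    exact LinearMap.ker_eq_bot.1 this

lemma isWeaklyRegular_iff_of_surjective {φ : M₁ →ₗ[R] M} (hφ : Function.Surjective φ)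
    {rs : List R} : IsWeaklyRegular M rs ↔ ∀ i (hi : i < rs.length), ∀ m : M₁,
      rs[i] • m ∈ LinearMap.ker φ ⊔ Ideal.ofList (rs.take i) • ⊤ →
        m ∈ LinearMap.ker φ ⊔ Ideal.ofList (rs.take i) • ⊤ := by
  have key (J : Ideal R) (m : M₁) :
      φ m ∈ J • (⊤ : Submodule R M) ↔ m ∈ LinearMap.ker φ ⊔ J • ⊤ := by
    rw [← Submodule.mem_comap, ← LinearMap.range_eq_top.2 hφ, LinearMap.range_eq_map,
      ← Submodule.map_smul'', Submodule.comap_map_eq, sup_comm]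
  rw [isWeaklyRegular_iff]
  refine forall₂_congr fun i hi ↦ ?_
  rw [isSMulRegular_quotient_iff_mem_of_smul_mem, hφ.forall]
  simp only [← map_smul, key]

lemma length_le_supportDim [IsNoetherianRing R] [Module.Finite R M] {rs : List R}
    (h : IsRegular M rs) : (rs.length : WithBot ℕ∞) ≤ supportDim R M := by
  induction rs generalizing M with
  | nil =>
    have := h.nontrivial
    have h1 := supportDim_ne_bot_of_nontrivial R M
    obtain ⟨n, hn⟩ := WithBot.ne_bot_iff_exists.1 h1
    rw [← hn]
    exact WithBot.coe_le_coe.2 bot_le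
  | cons r rs ih =>
    rw [isRegular_cons_iff] at h
    refine le_trans ?_ (supportDim_quotSMulTop_succ_le_of_notMem_minimalPrimes fun p hp ↦
      h.1.notMem_of_mem_minimalPrimes hp)
    rw [List.length_cons, Nat.cast_succ]
    exact add_le_add_left (ih h.2) 1

lemma isCM_of_isRegular [IsNoetherianRing R] [Module.Finite R M] {I : Ideal R} {rs : List R}
    (h : IsRegular M rs) (hI : ∀ r ∈ rs, r ∈ I) (hd : supportDim R M ≤ rs.length) :
    IsCM R I M := by
  have hdim := hd.antisymm (length_le_supportDim h)
  rw [IsCM, ← supportDim_eq_ringKrullDim_quotient_annihilator, hdim]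
  change ((mDepth R I M : ℕ∞) : WithBot ℕ∞) = ((rs.length : ℕ∞) : WithBot ℕ∞)
  rw [WithBot.coe_inj]
  refine le_antisymm (sSup_le ?_) (le_sSup ⟨rs, rfl, hI, h⟩)
  rintro _ ⟨rs', rfl, -, h'⟩
  have := (length_le_supportDim h').trans_eq hdim
  exact_mod_cast this

variable (A B : Ideal R)

lemma nonempty_equiv_quotient_colonBy (a : R) :
    Nonempty (↥(Submodule.map A.mkQ (A ⊔ Ideal.span {a})) ≃ₗ[R] R ⧸ colonBy A a) := by
  set φ : R →ₗ[R] R ⧸ A := A.mkQ ∘ₗ LinearMap.mulRight R a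
  have hker : LinearMap.ker φ = colonBy A a := by
    ext s
    rw [mem_colonBy]
    exact Submodule.Quotient.mk_eq_zero A
  have hran : LinearMap.range φ = Submodule.map A.mkQ (A ⊔ Ideal.span {a}) := by
    ext x
    simp only [φ, LinearMap.mem_range, Submodule.mem_map]
    constructor
    · rintro ⟨s, rfl⟩
      exact ⟨s * a, Ideal.mem_sup_right (Ideal.mul_mem_left _ _ (Ideal.mem_span_singleton_self _)),
        rfl⟩
    · rintro ⟨y, hy, rfl⟩
      obtain ⟨t, ht⟩ := mem_sup_span_singleton.1 hy
      refine ⟨t, ?_⟩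
      rw [LinearMap.comp_apply, Submodule.mkQ_apply, Submodule.mkQ_apply, eq_comm,
        Submodule.Quotient.eq]
      simpa [mul_comm] using ht
  rw [← hker, ← hran]
  exact ⟨φ.quotKerEquivRange.symm⟩

end Depth

section FiltCM

open RingTheory.Sequence Module

lemma isWeaklyRegular_quotient_varPrime {T : Finset (Fin 4)} {d : ℕ} (hT : T.card + d = 4)
    (hd : d ≤ 3) :
    IsWeaklyRegular (S ⧸ varPrime K T) ([sigma₁ K, sigma₂ K, sigma₃ K].take d) := by
  rw [isWeaklyRegular_iff_of_surjective (φ := (varPrime K T).mkQ) (Submodule.mkQ_surjective _)]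
  simp only [Submodule.ker_mkQ, smul_eq_mul, Ideal.mul_top]
  intro i hi s hs
  have hid : i < d ∧ i < 3 := by simpa using hi
  rw [List.getElem_take] at hs
  rw [List.take_take, min_eq_left hid.1.le] at *
  obtain ⟨hid, hi3⟩ := hid
  interval_cases i
  · simp at hs ⊢
    exact mem_of_sigma₁_mul_mem (by lia) hs
  · simp at hs ⊢
    exact mem_of_sigma₂_mul_mem (by lia) hs
  · simp [← sup_assoc] at hs ⊢
    exact mem_of_sigma₃_mul_mem (by lia) hs

lemma exists_exact_map_mkQ {R : Type*} [CommRing R] {A B C : Ideal R} (hAB : A ≤ B) (hBC : B ≤ C) :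
    ∃ (f : ↥(Submodule.map A.mkQ B) →ₗ[R] ↥(Submodule.map A.mkQ C))
      (g : ↥(Submodule.map A.mkQ C) →ₗ[R] ↥(Submodule.map B.mkQ C)),
      Function.Injective f ∧ Function.Exact f g ∧ Function.Surjective g := by
  have hg : ∀ x ∈ Submodule.map A.mkQ C, Submodule.factor hAB x ∈ Submodule.map B.mkQ C := by
    rintro _ ⟨y, hy, rfl⟩
    exact ⟨y, hy, rfl⟩
  refine ⟨Submodule.inclusion (Submodule.map_mono hBC), (Submodule.factor hAB).restrict hg,
    Submodule.inclusion_injective _, ?_, ?_⟩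
  · rintro ⟨_, y, hy, rfl⟩
    simp only [Set.mem_range, Subtype.ext_iff, LinearMap.coe_restrict_apply]
    constructor
    · intro h
      have : y ∈ B := (Submodule.Quotient.mk_eq_zero B).1 h
      exact ⟨⟨_, y, this, rfl⟩, rfl⟩
    · rintro ⟨⟨_, z, hz, rfl⟩, h⟩
      change A.mkQ z = A.mkQ y at h
      rw [← h]
      exact (Submodule.Quotient.mk_eq_zero B).2 hz
  · rintro ⟨_, y, hy, rfl⟩
    exact ⟨⟨_, y, hy, rfl⟩, rfl⟩

variable {d : ℕ} {A B : Ideal (MvPolynomial (Fin 4) K)}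

lemma Filt.isWeaklyRegular (h : Filt d A B) (hd : d ≤ 3) :
    IsWeaklyRegular ↥(Submodule.map A.mkQ B) ([sigma₁ K, sigma₂ K, sigma₃ K].take d) := by
  induction h with
  | refl A =>
    have : Subsingleton ↥(Submodule.map A.mkQ A) := by
      rw [Submodule.subsingleton_iff_eq_bot, Submodule.mkQ_map_self]
    rw [isWeaklyRegular_iff]
    intro i hi x y _
    exact Subsingleton.elim _ _
  | step a T hT ha h ih =>
    obtain ⟨f, g, hf, hfg, hg⟩ := exists_exact_map_mkQ (le_sup_left (b := Ideal.span {a})) h.le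
    refine isWeaklyRegular_of_exact hf hfg hg ?_ ih
    obtain ⟨e⟩ := nonempty_equiv_quotient_colonBy _ a
    rw [e.isWeaklyRegular_congr, ha]
    exact isWeaklyRegular_quotient_varPrime hT hd

lemma mem_support_quotient_iff {R : Type*} [CommRing R] {I : Ideal R} {p : PrimeSpectrum R} :
    p ∈ support R (R ⧸ I) ↔ I ≤ p.asIdeal := by
  rw [mem_support_iff_of_finite, Ideal.annihilator_quotient]

lemma Filt.exists_varPrime_le (h : Filt d A B) {p : PrimeSpectrum S}
    (hp : p ∈ support S ↥(Submodule.map A.mkQ B)) :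
    ∃ T, T.card + d = 4 ∧ varPrime K T ≤ p.asIdeal := by
  induction h with
  | refl A =>
    have : Subsingleton ↥(Submodule.map A.mkQ A) := by
      rw [Submodule.subsingleton_iff_eq_bot, Submodule.mkQ_map_self]
    rw [Module.support_eq_empty] at hp
    exact hp.elim
  | step a T hT ha h ih =>
    obtain ⟨f, g, hf, hfg, hg⟩ := exists_exact_map_mkQ (le_sup_left (b := Ideal.span {a})) h.le
    rw [support_of_exact hfg hf hg] at hp
    refine hp.elim (fun hp ↦ ⟨T, hT, ?_⟩) ih
    obtain ⟨e⟩ := nonempty_equiv_quotient_colonBy _ a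
    rwa [e.support_eq, ha, mem_support_quotient_iff] at hp

lemma Filt.supportDim_le (h : Filt d A B) : supportDim S ↥(Submodule.map A.mkQ B) ≤ d := by
  refine iSup_le fun p ↦ ?_
  obtain ⟨T, hT, hTp⟩ := h.exists_varPrime_le p.head.2
  have hmem : ∀ i, (p i).1 ∈ support S (S ⧸ varPrime K T) := fun i ↦ by
    rw [mem_support_quotient_iff]
    exact hTp.trans (p.head_le i)
  let q : LTSeries (support S (S ⧸ varPrime K T)) :=
    ⟨p.length, fun i ↦ ⟨(p i).1, hmem i⟩, fun i ↦ p.step i⟩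
  have hq : (q.length : WithBot ℕ∞) ≤ supportDim S (S ⧸ varPrime K T) :=
    le_iSup_iff.2 fun b hb ↦ hb q
  rw [supportDim_quotient_eq_ringKrullDim, ringKrullDim_quotient_varPrime] at hq
  rwa [show 4 - T.card = d by lia] at hq

lemma mem_varPrime_univ_of_mem_take {f : S} (hf : f ∈ [sigma₁ K, sigma₂ K, sigma₃ K].take d) :
    f ∈ varPrime K Finset.univ := by
  have := List.mem_of_mem_take hf
  simp only [List.mem_cons, List.not_mem_nil, or_false] at this
  rcases this with rfl | rfl | rfl
  exacts [sigma₁_mem, sigma₂_mem, sigma₃_mem]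

lemma Filt.isCM (h : Filt d A B) (hd : d ≤ 3) (hAB : Submodule.map A.mkQ B ≠ ⊥) :
    IsCM S (varPrime K Finset.univ) ↥(Submodule.map A.mkQ B) := by
  refine isCM_of_isRegular ⟨h.isWeaklyRegular hd, fun htop ↦ ?_⟩
    (fun r ↦ mem_varPrime_univ_of_mem_take) ?_
  · obtain ⟨r, hr, hr0⟩ := Submodule.exists_sub_one_mem_and_smul_eq_zero_of_fg_of_le_smul _ _
      Module.Finite.fg_top htop.le
    have hle : Ideal.ofList ([sigma₁ K, sigma₂ K, sigma₃ K].take d) ≤ varPrime K Finset.univ :=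
      Ideal.span_le.2 fun f ↦ mem_varPrime_univ_of_mem_take
    cases h with
    | refl => exact hAB (Submodule.mkQ_map_self A)
    | step a T hT ha h =>
      have haB : a ∈ B := h.le (Ideal.mem_sup_right (Ideal.mem_span_singleton_self a))
      have hra := hr0 ⟨A.mkQ a, a, haB, rfl⟩ trivial
      have hrT : r ∈ varPrime K T := by
        rw [← ha, mem_colonBy]
        exact (Submodule.Quotient.mk_eq_zero A).1 (congrArg Subtype.val hra)
      refine (isPrime_varPrime (K := K) Finset.univ).ne_top ((Ideal.eq_top_iff_one _).2 ?_)
      have := Ideal.sub_mem _ (varPrime_le_varPrime.2 (Finset.subset_univ T) hrT) (hle hr)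
      rwa [sub_sub_cancel] at this
  · convert! h.supportDim_le using 1
    simp [hd]

end FiltCM

section DepthTwo

open RingTheory.Sequence Module

lemma colonBy_sat_le {I : Ideal S} (hI : SuppClosed I) {U : Finset (Fin 4)} {n : Fin 4 →₀ ℕ}
    (hn : monomial n (1 : K) ∉ sat U I) :
    colonBy (sat U I) (monomial n 1) ≤ varPrime K Uᶜ := by
  rw [((hI.sat U).colonBy n).le_iff]
  intro e he
  rw [mem_colonBy, monomial_mul, one_mul] at he
  by_contra hcon
  simp only [monomial_mem_varPrime, Finset.mem_compl, not_exists, not_and, not_not] at hcon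
  refine hn ((mul_monomial_mem_sat (N := ∑ i, e i)).1 ?_)
  rw [monomial_mul, one_mul]
  refine monomial_mem_of_le (fun i ↦ ?_) he
  by_cases hi : i ∈ U
  · have := Finset.single_le_sum (fun j _ ↦ Nat.zero_le (e j)) (Finset.mem_univ i)
    simp [ind_apply, hi]
    lia
  · simp [hcon i hi]

lemma two_le_ringKrullDim {I B : Ideal S} (hI : SuppClosed I) (hB : SuppClosed B)
    (hne : ¬ B ≤ satDim 2 I) :
    2 ≤ ringKrullDim (S ⧸ annihilator S ↥(Submodule.map (satDim 2 I).mkQ B)) := by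
  rw [hB.le_iff] at hne
  push Not at hne
  obtain ⟨n, hn, hn'⟩ := hne
  rw [mem_satDim] at hn'
  push Not at hn'
  obtain ⟨U, hU, hnU⟩ := hn'
  have hle : annihilator S ↥(Submodule.map (satDim 2 I).mkQ B) ≤ varPrime K Uᶜ := by
    refine le_trans (fun r hr ↦ ?_) (colonBy_sat_le hI hnU)
    have h0 := mem_annihilator.1 hr ⟨(satDim 2 I).mkQ (monomial n 1), _, hn, rfl⟩
    rw [mem_colonBy]
    refine (hU ▸ satDim_le_sat) ((Submodule.Quotient.mk_eq_zero (satDim 2 I)).1 ?_)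
    exact congrArg Subtype.val h0
  have h1 := ringKrullDim_le_of_surjective _ (Ideal.Quotient.factor_surjective hle)
  rw [ringKrullDim_quotient_varPrime, Finset.card_compl, hU] at h1
  exact h1

lemma regPair_of_isWeaklyRegular {R : Type*} [CommRing R] {A B : Ideal R} {f g : R} {rs : List R}
    (h : IsWeaklyRegular ↥(Submodule.map A.mkQ B) (f :: g :: rs)) : RegPair f g A B := by
  have hφ : Function.Surjective (A.mkQ.restrict (fun b (hb : b ∈ B) ↦
      Submodule.mem_map_of_mem (f := A.mkQ) hb)) := by
    rintro ⟨_, y, hy, rfl⟩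
    exact ⟨⟨y, hy⟩, rfl⟩
  rw [isWeaklyRegular_iff_of_surjective hφ] at h
  have hker (b : B) : b ∈ LinearMap.ker (A.mkQ.restrict (fun b (hb : b ∈ B) ↦
      Submodule.mem_map_of_mem (f := A.mkQ) hb)) ↔ (b : R) ∈ A := by
    rw [LinearMap.mem_ker, Subtype.ext_iff]
    exact Submodule.Quotient.mk_eq_zero A
  have h0 := h 0 (by simp)
  have h1 := h 1 (by simp)
  simp [hker] at h0
  have hmem (b : B) : b ∈ LinearMap.ker (A.mkQ.restrict (fun b (hb : b ∈ B) ↦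
      Submodule.mem_map_of_mem (f := A.mkQ) hb)) ⊔ Ideal.ofList [f] • ⊤ ↔
      ∃ t ∈ B, b - f * t ∈ A := by
    rw [Ideal.ofList_singleton, Submodule.ideal_span_singleton_smul, Submodule.mem_sup]
    constructor
    · rintro ⟨y, hy, z, hz, rfl⟩
      obtain ⟨t, -, rfl⟩ := (Submodule.mem_smul_pointwise_iff_exists _ _ _).1 hz
      exact ⟨t, t.2, by simpa [hker] using hy⟩
    · rintro ⟨t, ht, hbt⟩
      refine ⟨b - f • ⟨t, ht⟩, (hker _).2 (by simpa using hbt), f • ⟨t, ht⟩, ?_, by simp⟩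
      exact (Submodule.mem_smul_pointwise_iff_exists _ _ _).2 ⟨⟨t, ht⟩, trivial, rfl⟩
  refine ⟨fun s hs hfs ↦ h0 s hs hfs, fun b hb hbt ↦ ?_⟩
  have := h1 ⟨b, hb⟩
  simp only [List.take_succ_cons, List.take_zero, hmem] at this
  exact this hbt

lemma exists_regPair_of_isCM {I B : Ideal S} (hI : SuppClosed I) (hB : SuppClosed B)
    {J : Ideal S} (hne : Submodule.map (satDim 2 I).mkQ B ≠ ⊥)
    (h : IsCM S J ↥(Submodule.map (satDim 2 I).mkQ B)) :
    ∃ f ∈ J, ∃ g ∈ J, RegPair f g (satDim 2 I) B := by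
  have h2 := two_le_ringKrullDim hI hB fun hle ↦ hne <| by
    rw [eq_bot_iff]
    rintro _ ⟨y, hy, rfl⟩
    exact (Submodule.Quotient.mk_eq_zero _).2 (hle hy)
  rw [IsCM] at h
  rw [← h] at h2
  have h3 : (2 : ℕ∞) ≤ mDepth S J ↥(Submodule.map (satDim 2 I).mkQ B) := WithBot.coe_le_coe.1 h2
  obtain ⟨_, ⟨rs, rfl, hrs, hreg⟩, hlt⟩ :=
    lt_sSup_iff.1 (lt_of_lt_of_le (by norm_cast : (1 : ℕ∞) < 2) h3)
  have hlen : 1 < rs.length := by exact_mod_cast hlt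
  match rs, hlen with
  | f :: g :: rs, _ =>
    exact ⟨f, hrs f (by simp), g, hrs g (by simp), regPair_of_isWeaklyRegular hreg.1⟩

end DepthTwo

section PrettyCleanOfFilt

/-- `S / A` has a pretty clean filtration by quotients of the form `S / varPrime K T` of dimension
at least `d`. -/
def HasPrettyFilt (d : ℕ) (A : Ideal (MvPolynomial (Fin 4) K)) : Prop :=
  ∃ (r : ℕ) (F : Fin (r + 1) → Ideal (MvPolynomial (Fin 4) K))
    (P : Fin r → Ideal (MvPolynomial (Fin 4) K)), IsPrimeFiltration A r F P ∧
    (∀ i j : Fin r, i ≤ j → P i ≤ P j → P i = P j) ∧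
    ∀ i, ∃ T : Finset (Fin 4), P i = varPrime K T ∧ T.card + d ≤ 4

lemma HasPrettyFilt.mono {d d' : ℕ} {A : Ideal S} (h : HasPrettyFilt d A) (hd : d' ≤ d) :
    HasPrettyFilt d' A := by
  obtain ⟨r, F, P, h1, h2, h3⟩ := h
  refine ⟨r, F, P, h1, h2, fun i ↦ ?_⟩
  obtain ⟨T, hT, hT'⟩ := h3 i
  exact ⟨T, hT, by lia⟩

lemma hasPrettyFilt_top (d : ℕ) : HasPrettyFilt d (⊤ : Ideal S) :=
  ⟨0, fun _ ↦ ⊤, Fin.elim0, ⟨rfl, rfl, fun i ↦ i.elim0, fun i ↦ i.elim0⟩, fun i ↦ i.elim0,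
    fun i ↦ i.elim0⟩

lemma Filt.hasPrettyFilt {d : ℕ} {A B : Ideal S} (h : Filt d A B) (hB : HasPrettyFilt d B) :
    HasPrettyFilt d A := by
  induction h with
  | refl => exact hB
  | @step A B a T hT ha _ ih =>
    obtain ⟨r, F, P, ⟨hF0, hFl, hF, hP⟩, h2, h3⟩ := ih hB
    refine ⟨r + 1, Fin.cons A F, Fin.cons (varPrime K T) P, ⟨rfl, ?_, ?_, ?_⟩, ?_, ?_⟩
    · rw [← Fin.succ_last, Fin.cons_succ, hFl]
    · refine Fin.cases ?_ fun i ↦ ?_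
      · simp [hF0]
      · simpa [← Fin.succ_castSucc] using hF i
    · refine Fin.cases ⟨isPrime_varPrime T, ?_⟩ hP
      have := nonempty_equiv_quotient_colonBy A a
      rwa [ha, ← hF0] at this
    · refine Fin.cases (Fin.cases (fun _ _ ↦ rfl) fun j _ hj ↦ ?_) fun i ↦ Fin.cases ?_ ?_
      · obtain ⟨T', hT', hc⟩ := h3 j
        simp only [Fin.cons_zero, Fin.cons_succ, hT'] at hj ⊢
        rw [Finset.eq_of_subset_of_card_le (varPrime_le_varPrime.1 hj) (by lia)]
      · intro hi
        exact absurd hi (by simp)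
      · intro j hij
        simpa using h2 i j (by simpa using hij)
    · exact Fin.cases ⟨T, rfl, hT.le⟩ h3

lemma isPrettyClean_of_filt {A : Ideal S} (hA : SuppClosed A) (h0 : A ≠ ⊥)
    (h2 : Filt 2 (satDim 2 A) (satDim 3 A)) : IsPrettyClean A := by
  have h4 : HasPrettyFilt 4 (satDim 4 A) := satDim_four hA h0 ▸ hasPrettyFilt_top 4
  have h3 := (filt_satDim hA h0 (d := 3) (by simp) (by simp)).hasPrettyFilt (h4.mono (by simp))
  have h1 := (filt_satDim hA h0 (d := 1) (by simp) (by simp)).hasPrettyFilt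
    ((h2.hasPrettyFilt (h3.mono (by simp))).mono (by simp))
  obtain ⟨r, F, P, h, h', -⟩ :=
    (filt_satDim hA h0 (d := 0) (by simp) (by simp)).hasPrettyFilt (h1.mono (by simp))
  rw [satDim_zero] at h
  exact ⟨r, F, P, h, h'⟩

lemma isPrettyClean_bot {R : Type*} [CommRing R] [IsDomain R] : IsPrettyClean (⊥ : Ideal R) := by
  refine ⟨1, ![⊥, ⊤], ![⊥], ⟨rfl, rfl, fun i ↦ ?_, fun i ↦ ?_⟩, fun i j _ _ ↦ ?_⟩
  · fin_cases i
    simp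
  · fin_cases i
    refine ⟨Ideal.isPrime_bot, ?_⟩
    have := nonempty_equiv_quotient_colonBy (⊥ : Ideal R) 1
    have h1 : colonBy (⊥ : Ideal R) 1 = ⊥ := by
      ext f
      simp [mem_colonBy]
    rwa [h1, Ideal.span_singleton_one, bot_sup_eq] at this
  · rw [Subsingleton.elim i j]

end PrettyCleanOfFilt

section RegPairExtension

variable {R : Type*} [CommRing R] {f g : R} {A : Ideal R}

lemma RegPair.pow_left (h : RegPair f g A ⊤) (N : ℕ) : RegPair (f ^ N) g A ⊤ := by
  induction N with
  | zero => exact ⟨fun s _ hs ↦ by simpa using hs, fun b _ _ ↦ ⟨b, trivial, by simp⟩⟩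
  | succ N ih =>
    refine ⟨fun s _ hs ↦ ih.1 s trivial (h.1 _ trivial ?_), fun b _ ⟨t, _, hbt⟩ ↦ ?_⟩
    · rwa [pow_succ', mul_assoc] at hs
    · obtain ⟨t₁, -, h₁⟩ := h.2 b trivial ⟨f ^ N * t, trivial, by rwa [← mul_assoc, ← pow_succ']⟩
      obtain ⟨t₂, -, h₂⟩ := ih.2 t₁ trivial ⟨t, trivial, h.1 _ trivial (by
        have := A.sub_mem hbt (A.mul_mem_left g h₁)
        ring_nf at this ⊢
        exact this)⟩
      refine ⟨t₂, trivial, ?_⟩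
      have := A.add_mem h₁ (A.mul_mem_left f h₂)
      ring_nf at this ⊢
      exact this

lemma RegPair.pow_right (h : RegPair f g A ⊤) (N : ℕ) : RegPair f (g ^ N) A ⊤ := by
  induction N with
  | zero => exact ⟨h.1, fun b _ ⟨t, ht, hbt⟩ ↦ ⟨t, ht, by simpa using hbt⟩⟩
  | succ N ih =>
    refine ⟨h.1, fun b _ ⟨t, ht, hbt⟩ ↦ ih.2 b trivial (h.2 _ trivial ⟨t, ht, ?_⟩)⟩
    rwa [← mul_assoc, ← pow_succ']

lemma RegPair.congr {f' g' : R} (h : RegPair f g A ⊤) (hf : f' - f ∈ A) (hg : g' - g ∈ A) :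
    RegPair f' g' A ⊤ := by
  have key {t : R} : f' * t ∈ A → f * t ∈ A := fun ht ↦ by
    have := A.sub_mem ht (A.mul_mem_right t hf)
    ring_nf at this ⊢
    exact this
  refine ⟨fun s hs hfs ↦ h.1 s hs (key hfs), fun b hb ⟨t, ht, hbt⟩ ↦ ?_⟩
  obtain ⟨t', ht', h'⟩ := h.2 b hb ⟨t, ht, by
    have := A.add_mem (A.sub_mem hbt (A.mul_mem_right b hg)) (A.mul_mem_right t hf)
    ring_nf at this ⊢
    exact this⟩
  refine ⟨t', ht', ?_⟩
  have := A.sub_mem h' (A.mul_mem_right t' hf)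
  ring_nf at this ⊢
  exact this

lemma regPair_of_colonBy {a : R} (hP : RegPair f g (colonBy A a) ⊤)
    (h : RegPair f g (A ⊔ Ideal.span {a}) ⊤) : RegPair f g A ⊤ := by
  refine ⟨fun s _ hs ↦ ?_, fun b _ ⟨t, _, hbt⟩ ↦ ?_⟩
  · obtain ⟨u, hu⟩ := mem_sup_span_singleton.1 (h.1 s trivial (Ideal.mem_sup_left hs))
    have hu' : u * a ∈ A := hP.1 u trivial (mem_colonBy.2 (by
      have := A.sub_mem hs (A.mul_mem_left f hu)
      ring_nf at this ⊢
      exact this))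
    simpa [mul_comm] using A.add_mem hu hu'
  · obtain ⟨t', -, h'⟩ := h.2 b trivial ⟨t, trivial, Ideal.mem_sup_left hbt⟩
    obtain ⟨u, hu⟩ := mem_sup_span_singleton.1 h'
    have h₁ : f * (g * t' - t) ∈ A ⊔ Ideal.span {a} := mem_sup_span_singleton.2 ⟨-(g * u), by
      have := A.sub_mem hbt (A.mul_mem_left g hu)
      ring_nf at this ⊢
      exact this⟩
    obtain ⟨v, hv⟩ := mem_sup_span_singleton.1 (h.1 _ trivial h₁)
    obtain ⟨w, -, hw⟩ := hP.2 u trivial ⟨-v, trivial, mem_colonBy.2 (by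
      have := A.sub_mem (A.sub_mem hbt (A.mul_mem_left g hu)) (A.mul_mem_left f hv)
      ring_nf at this ⊢
      exact this)⟩
    rw [mem_colonBy] at hw
    refine ⟨t' + w * a, trivial, ?_⟩
    have := A.add_mem hu hw
    ring_nf at this ⊢
    exact this

lemma mul_mem_of_mem_colonBy {a p x : R} (hp : p ∈ colonBy A a) (hx : x ∈ A ⊔ Ideal.span {a}) :
    p * x ∈ A := by
  obtain ⟨u, hu⟩ := mem_sup_span_singleton.1 hx
  rw [mem_colonBy] at hp
  have := A.add_mem (A.mul_mem_left p hu) (A.mul_mem_left u hp)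
  ring_nf at this
  exact this

end RegPairExtension

section PrimeChain

/-- `PrimeChain A l` says that `S / A` has a filtration with successive factors
`S / varPrime K T` for `T` in the list `l`. -/
inductive PrimeChain : Ideal (MvPolynomial (Fin 4) K) → List (Finset (Fin 4)) → Prop
  | top : PrimeChain ⊤ []
  | cons {A : Ideal (MvPolynomial (Fin 4) K)} {T : Finset (Fin 4)} {l : List (Finset (Fin 4))}
      (a : MvPolynomial (Fin 4) K) (ha : colonBy A a = varPrime K T)
      (h : PrimeChain (A ⊔ Ideal.span {a}) l) : PrimeChain A (T :: l)

variable {A : Ideal (MvPolynomial (Fin 4) K)} {a : MvPolynomial (Fin 4) K} {T : Finset (Fin 4)}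

lemma exists_disjoint_of_card_le_two (hT : T.card ≤ 2) :
    ∃ U : Finset (Fin 4), U.card = 2 ∧ Disjoint U T := by
  obtain ⟨U, hU, hc⟩ := Finset.exists_subset_card_eq (s := Tᶜ) (n := 2) (by
    rw [Finset.card_compl, Fintype.card_fin]
    lia)
  exact ⟨U, hc, Finset.disjoint_left.2 fun i hi ↦ Finset.mem_compl.1 (hU hi)⟩

lemma colonBy_satDim_two (ha : colonBy A a = varPrime K T) (hT : T.card ≤ 2) :
    colonBy (satDim 2 A) a = varPrime K T := by
  refine le_antisymm (fun f hf ↦ ?_) (ha ▸ fun f hf ↦ le_satDim hf)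
  obtain ⟨U, hU, hUT⟩ := exists_disjoint_of_card_le_two hT
  obtain ⟨N, hN⟩ := mem_satDim.1 hf U hU
  have h : f * monomial (N • ind U) 1 ∈ varPrime K T := by
    rw [← ha, mem_colonBy, mul_right_comm]
    exact hN
  refine ((isPrime_varPrime T).mem_or_mem h).resolve_right fun hm ↦ ?_
  have := (monomial_ind_mem_varPrime (T := T) (U := U) N.succ_ne_zero).1 (by
    rw [succ_nsmul, ← one_mul (1 : K), ← monomial_mul]
    exact Ideal.mul_mem_right _ _ hm)
  exact this hUT

lemma satDim_two_sup_span (ha : colonBy A a = varPrime K T) (hT : 3 ≤ T.card) :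
    satDim 2 (A ⊔ Ideal.span {a}) = satDim 2 A := by
  refine le_antisymm (fun f hf ↦ mem_satDim.2 fun U hU ↦ ?_) (satDim_mono le_sup_left)
  obtain ⟨N, hN⟩ := mem_satDim.1 hf U hU
  have hm : monomial (1 • ind U) (1 : K) ∈ colonBy A a := by
    rw [ha, monomial_ind_mem_varPrime one_ne_zero]
    intro hd
    have := (Finset.card_union_of_disjoint hd).symm.trans_le (Finset.card_le_univ _)
    rw [Fintype.card_fin] at this
    lia
  refine ⟨1 + N, ?_⟩
  rw [add_smul, ← one_mul (1 : K), ← monomial_mul, mul_left_comm]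
  exact mul_mem_of_mem_colonBy hm hN

lemma PrimeChain.exists_pow_sub_mul_mem {l : List (Finset (Fin 4))} (h : PrimeChain A l)
    {P : Ideal (MvPolynomial (Fin 4) K)}
    (hP : ∀ T ∈ l, 3 ≤ T.card → varPrime K Finset.univ ≤ P ⊔ varPrime K T)
    {x : S} (hx : x ∈ varPrime K Finset.univ) {e : S} (he : e ∈ satDim 2 A) :
    ∃ N : ℕ, ∃ q, q - x ^ N ∈ P ∧ q * e ∈ A := by
  induction h with
  | top => exact ⟨0, 1, by simp, trivial⟩
  | @cons A T l a ha _ ih =>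
    obtain ⟨N, q, hq, hqe⟩ := ih (fun T' hT' ↦ hP T' (List.mem_cons_of_mem _ hT'))
      (satDim_mono le_sup_left he)
    by_cases hT : 3 ≤ T.card
    · obtain ⟨p, hp, p', hp', rfl⟩ := Submodule.mem_sup.1 (hP T List.mem_cons_self hT hx)
      refine ⟨N + 1, p' * q, ?_, ?_⟩
      · have := P.sub_mem (P.mul_mem_left p' hq) (P.mul_mem_right ((p + p') ^ N) hp)
        ring_nf at this ⊢
        exact this
      · rw [mul_assoc]
        exact mul_mem_of_mem_colonBy (ha ▸ hp') hqe
    · refine ⟨N, q, hq, ?_⟩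
      obtain ⟨u, hu⟩ := mem_sup_span_singleton.1 hqe
      have hua : u ∈ colonBy (satDim 2 A) a := by
        rw [mem_colonBy]
        have := (satDim 2 A).sub_mem ((satDim 2 A).mul_mem_left q he) (le_satDim hu)
        rwa [sub_sub_cancel, mul_comm] at this
      rw [colonBy_satDim_two ha (by lia), ← ha, mem_colonBy] at hua
      have := A.add_mem hu hua
      rwa [mul_comm a, sub_add_cancel] at this

lemma satDim_two_sup_span_of_regPair {f g : S} (ha : colonBy A a = varPrime K T)
    (hfg : RegPair f g (varPrime K T) ⊤)
    (hf : ∀ e ∈ satDim 2 (A ⊔ Ideal.span {a}), ∃ N : ℕ, ∃ q, q - f ^ N ∈ varPrime K T ∧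
      q * e ∈ A ⊔ Ideal.span {a})
    (hg : ∀ e ∈ satDim 2 (A ⊔ Ideal.span {a}), ∃ N : ℕ, ∃ q, q - g ^ N ∈ varPrime K T ∧
      q * e ∈ A ⊔ Ideal.span {a}) :
    satDim 2 (A ⊔ Ideal.span {a}) = satDim 2 A ⊔ Ideal.span {a} := by
  refine le_antisymm (fun e he ↦ ?_) (sup_le (satDim_mono le_sup_left)
    (le_sup_right.trans le_satDim))
  obtain ⟨N, f', hf', hfe⟩ := hf e he
  obtain ⟨M, g', hg', hge⟩ := hg e he
  obtain ⟨u, hu⟩ := mem_sup_span_singleton.1 hfe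
  obtain ⟨v, hv⟩ := mem_sup_span_singleton.1 hge
  have hreg := ((hfg.pow_left N).pow_right M).congr hf' hg'
  obtain ⟨t, -, ht⟩ := hreg.2 u trivial ⟨v, trivial, by
    rw [← ha, mem_colonBy]
    have := A.sub_mem (A.mul_mem_left f' hv) (A.mul_mem_left g' hu)
    ring_nf at this ⊢
    exact this⟩
  rw [← ha, mem_colonBy] at ht
  have hfe' : f' * (e - t * a) ∈ A := by
    have := A.add_mem hu ht
    ring_nf at this ⊢
    exact this
  refine mem_sup_span_singleton.2 ⟨t, mem_satDim.2 fun U hU ↦ ?_⟩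
  obtain ⟨L, hL⟩ := mem_satDim.1 ((satDim 2 _).sub_mem he (le_satDim
    (Ideal.mem_sup_right (Ideal.mul_mem_left _ t (Ideal.mem_span_singleton_self a))))) U hU
  refine ⟨L, ?_⟩
  obtain ⟨s, hs⟩ := mem_sup_span_singleton.1 hL
  have hsa : s ∈ varPrime K T := hreg.1 s trivial (by
    rw [← ha, mem_colonBy]
    have := A.sub_mem (A.mul_mem_right (monomial (L • ind U) 1) hfe') (A.mul_mem_left f' hs)
    ring_nf at this ⊢
    exact this)
  rw [← ha, mem_colonBy] at hsa
  have := A.add_mem hs hsa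
  rwa [mul_comm s, sub_add_cancel, mul_comm t] at this

lemma PrimeChain.regPair {l : List (Finset (Fin 4))} (h : PrimeChain A l)
    (hl : l.Pairwise fun T T' ↦ T ⊆ T' → T = T') :
    RegPair (sigma₁ K) (sigma₂ K) (satDim 2 A) ⊤ := by
  induction h with
  | top => exact ⟨fun _ _ _ ↦ le_satDim trivial, fun b _ _ ↦ ⟨b, trivial, le_satDim trivial⟩⟩
  | @cons A T l a ha h ih =>
    rw [List.pairwise_cons] at hl
    have ih := ih hl.2
    by_cases hT : 3 ≤ T.card
    · rwa [satDim_two_sup_span ha hT] at ih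
    · have hT2 : T.card ≤ 2 := by lia
      have hfg := regPair_varPrime (K := K) hT2
      have hP : ∀ T' ∈ l, 3 ≤ T'.card →
          varPrime K Finset.univ ≤ varPrime K T ⊔ varPrime K T' := by
        intro T' hT' hc
        have hnot : ¬ T ⊆ T' := fun hs ↦ by
          have := congrArg Finset.card (hl.1 T' hT' hs)
          lia
        have hlt : T'.card < (T ∪ T').card := Finset.card_lt_card
          ⟨Finset.subset_union_right, fun hs ↦ hnot (Finset.subset_union_left.trans hs)⟩
        have huniv : T ∪ T' = Finset.univ := (Finset.card_eq_iff_eq_univ _).1 (by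
          have := Finset.card_le_univ (T ∪ T')
          rw [Fintype.card_fin] at this ⊢
          lia)
        rw [varPrime_le_iff]
        intro i _
        rcases Finset.mem_union.1 (huniv ▸ Finset.mem_univ i) with hi | hi
        · exact Ideal.mem_sup_left (X_mem_varPrime.2 hi)
        · exact Ideal.mem_sup_right (X_mem_varPrime.2 hi)
      rw [satDim_two_sup_span_of_regPair ha hfg
        (fun e he ↦ h.exists_pow_sub_mul_mem hP sigma₁_mem he)
        (fun e he ↦ h.exists_pow_sub_mul_mem hP sigma₂_mem he)] at ih
      exact regPair_of_colonBy (colonBy_satDim_two ha hT2 ▸ hfg) ih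

lemma regPair_satDim_three {f g : S} (h : RegPair f g (satDim 2 A) ⊤) :
    RegPair f g (satDim 2 A) (satDim 3 A) := by
  refine h.of_le (satDim_le_satDim (by simp)) le_top fun t ht hft ↦ mem_satDim.2 fun U hU ↦ ?_
  have hmem := h.mem_sat ht (sat_mono le_satDim (mem_satDim.1 hft U hU))
  have hle : satDim 2 A ≤ sat U A := (satDim_le_satDim (by lia)).trans satDim_le_sat
  rw [← sat_sat]
  exact sat_mono hle hmem

end PrimeChain

section OfIsPrettyClean

lemma exists_eq_sup_span_of_equiv {R : Type*} [CommRing R] {A B P : Ideal R} (hAB : A ≤ B)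
    (e : ↥(Submodule.map A.mkQ B) ≃ₗ[R] R ⧸ P) :
    ∃ a, B = A ⊔ Ideal.span {a} ∧ colonBy A a = P := by
  obtain ⟨a, haB, ha⟩ := (e.symm 1).2
  have key (f : R) : (e.symm (Ideal.Quotient.mk P f) : R ⧸ A) = A.mkQ (f * a) := by
    have : Ideal.Quotient.mk P f = f • (1 : R ⧸ P) := by simp [Algebra.smul_def]
    rw [this, map_smul, Submodule.coe_smul, ← ha, ← map_smul, smul_eq_mul]
  refine ⟨a, le_antisymm (fun b hb ↦ ?_)
    (sup_le hAB ((Ideal.span_singleton_le_iff_mem B).2 haB)), ?_⟩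
  · obtain ⟨f, hf⟩ := Ideal.Quotient.mk_surjective (e ⟨A.mkQ b, b, hb, rfl⟩)
    have := key f
    rw [hf, e.symm_apply_apply] at this
    exact mem_sup_span_singleton.2 ⟨f, by
      rw [mul_comm]
      exact (Submodule.Quotient.eq A).1 this⟩
  · ext f
    rw [mem_colonBy, ← Ideal.Quotient.eq_zero_iff_mem (I := P), ← e.symm.map_eq_zero_iff,
      Subtype.ext_iff, key]
    exact (Submodule.Quotient.mk_eq_zero A).symm

lemma exists_colonBy_eq_of_chain {R : Type*} [CommRing R] {r : ℕ} {F : Fin (r + 1) → Ideal R}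
    {P : Fin r → Ideal R} {a : Fin r → R} (hP : ∀ i, (P i).IsPrime)
    (hF : ∀ i, F i.succ = F i.castSucc ⊔ Ideal.span {a i})
    (ha : ∀ i, colonBy (F i.castSucc) (a i) = P i)
    (hpc : ∀ i j : Fin r, i ≤ j → P i ≤ P j → P i = P j) (i : Fin r) :
    ∃ f, colonBy (F 0) f = P i := by
  obtain ⟨j, hj, hmin⟩ := exists_minimal_of_wellFoundedLT (fun j ↦ P j = P i) ⟨i, rfl⟩
  have key (k : Fin (r + 1)) (hk : k ≤ j.castSucc) : ∃ h ∉ P j, ∀ x ∈ F k, h * x ∈ F 0 := by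
    induction k using Fin.induction with
    | zero => exact ⟨1, (Ideal.ne_top_iff_one _).1 (hP j).ne_top, by simp⟩
    | succ k ih =>
      have hkj : k < j := Fin.castSucc_lt_castSucc_iff.1 (Fin.castSucc_lt_iff_succ_le.2 hk)
      obtain ⟨h, hh, hF0⟩ := ih hkj.le
      obtain ⟨p, hp, hpj⟩ := Set.not_subset.1 fun hle : P k ≤ P j ↦
        (hmin ((hpc k j hkj.le hle).trans hj) hkj.le).not_gt hkj
      refine ⟨h * p, fun hm ↦ ((hP j).mem_or_mem hm).elim hh hpj, fun x hx ↦ ?_⟩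
      rw [mul_assoc]
      exact hF0 _ (mul_mem_of_mem_colonBy (ha k ▸ hp) (hF k ▸ hx))
  have hmono (k : Fin (r + 1)) : F 0 ≤ F k := by
    induction k using Fin.induction with
    | zero => exact le_rfl
    | succ k ih => exact ih.trans (hF k ▸ le_sup_left)
  obtain ⟨h, hh, hF0⟩ := key _ le_rfl
  refine ⟨h * a j, hj ▸ le_antisymm (fun f hf ↦ ?_) fun f hf ↦ ?_⟩
  · rw [mem_colonBy, ← mul_assoc] at hf
    exact ((hP j).mem_or_mem (ha j ▸ mem_colonBy.2 (hmono _ hf))).resolve_right hh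
  · rw [mem_colonBy, mul_left_comm]
    rw [← ha j, mem_colonBy] at hf
    exact hF0 _ hf

lemma primeChain_ofFn {r : ℕ} {F : Fin (r + 1) → Ideal S} {T : Fin r → Finset (Fin 4)}
    {a : Fin r → S} (hlast : F (Fin.last r) = ⊤)
    (hF : ∀ i, F i.succ = F i.castSucc ⊔ Ideal.span {a i})
    (ha : ∀ i, colonBy (F i.castSucc) (a i) = varPrime K (T i)) :
    PrimeChain (F 0) (List.ofFn T) := by
  induction r with
  | zero =>
    rw [show F 0 = ⊤ from hlast, List.ofFn_zero]
    exact .top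
  | succ r ih =>
    rw [List.ofFn_succ]
    refine .cons (a 0) (ha 0) ?_
    have := ih (F := fun i ↦ F i.succ) (T := fun i ↦ T i.succ) (a := fun i ↦ a i.succ) hlast
      (fun i ↦ hF i.succ) (fun i ↦ ha i.succ)
    rwa [hF 0] at this

lemma filt_two_of_isPrettyClean {I : Ideal S} (hI : SuppClosed I) (h0 : I ≠ ⊥)
    (h : IsPrettyClean I) : Filt 2 (satDim 2 I) (satDim 3 I) := by
  obtain ⟨r, F, P, ⟨rfl, hlast, hmono, hP⟩, hpc⟩ := h
  choose a hF ha using fun i ↦ exists_eq_sup_span_of_equiv (hmono i) (hP i).2.some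
  have hT (i : Fin r) : ∃ T, P i = varPrime K T := by
    obtain ⟨f, hf⟩ := exists_colonBy_eq_of_chain (fun i ↦ (hP i).1) hF ha hpc i
    exact hI.eq_varPrime (hP i).1 hf
  choose T hT using hT
  have hchain := primeChain_ofFn hlast hF fun i ↦ (ha i).trans (hT i)
  refine filt_two_of_regPair hI h0 sigma₁_mem sigma₂_mem
    (regPair_satDim_three (hchain.regPair (List.pairwise_ofFn.2 fun i j hij hTij ↦ ?_)))
  have := hpc i j hij.le
  rw [hT i, hT j, varPrime_le_varPrime] at this
  exact hTij.antisymm (varPrime_le_varPrime.1 (this hTij).ge)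

end OfIsPrettyClean

section Main

lemma span_X_eq_varPrime_univ : m4 = varPrime K Finset.univ := by
  rw [varPrime]
  congr 1
  ext p
  simp [Fin.exists_fin_succ, eq_comm]

lemma satDim_bot {d : ℕ} (hd : d ≤ 4) : satDim d (⊥ : Ideal S) = ⊥ := by
  rw [eq_bot_iff]
  intro f hf
  obtain ⟨U, -, hU⟩ := Finset.exists_subset_card_eq (s := (Finset.univ : Finset (Fin 4))) (n := d)
    (by simpa using hd)
  obtain ⟨N, hN⟩ := mem_satDim.1 hf U hU
  simpa using hN

lemma map_mkQ_eq_bot_iff {R : Type*} [CommRing R] {A B : Ideal R} :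
    Submodule.map A.mkQ B = ⊥ ↔ B ≤ A := by
  rw [← le_bot_iff, Submodule.map_le_iff_le_comap, ← LinearMap.ker, Submodule.ker_mkQ]

lemma isPrettyClean_iff {I : Ideal S} (hI : SuppClosed I) :
    IsPrettyClean I ↔ ∀ d < 4, Submodule.map (satDim d I).mkQ (satDim (d + 1) I) ≠ ⊥ →
      IsCM S m4 ↥(Submodule.map (satDim d I).mkQ (satDim (d + 1) I)) := by
  by_cases h0 : I = ⊥
  · subst h0
    refine iff_of_true isPrettyClean_bot fun d hd hne ↦ absurd ?_ hne
    rw [map_mkQ_eq_bot_iff, satDim_bot hd]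
    exact bot_le
  rw [span_X_eq_varPrime_univ]
  constructor
  · intro h d hd hne
    by_cases h2 : d = 2
    · subst h2
      exact (filt_two_of_isPrettyClean hI h0 h).isCM (by simp) hne
    · exact (filt_satDim hI h0 hd h2).isCM (by lia) hne
  · intro h
    refine isPrettyClean_of_filt hI h0 ?_
    by_cases hne : Submodule.map (satDim 2 I).mkQ (satDim 3 I) = ⊥
    · rw [← (satDim_le_satDim (by simp)).antisymm (map_mkQ_eq_bot_iff.1 hne)]
      exact .refl _
    · obtain ⟨f, hf, g, hg, hfg⟩ :=
        exists_regPair_of_isCM hI (hI.satDim 3) hne (h 2 (by simp) hne)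
      exact filt_two_of_regPair hI h0 hf hg hfg

end Main

end PrettyClean

/-- For a monomial ideal `I ⊆ K[x,y,z,w]`, the quotient `S/I` is
pretty clean if and only if it is sequentially Cohen–Macaulay, where the
sequentially Cohen–Macaulay condition is expressed via the dimension filtration
`I = D₋₁(I) ⊆ D₀(I) ⊆ D₁(I) ⊆ D₂(I) ⊆ D₃(I) = S` (here `D i` denotes `D_{i-1}(I)`)
coming from an irredundant primary decomposition `I = ⋂_{p ∈ Ass(S/I)} Q p`. -/
theorem stmt_0 (I : Ideal S) (hI : IsMonomialIdeal I)
    (Q : Ideal S → Ideal S)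
    (hQ : ∀ p ∈ associatedPrimes S (S ⧸ I), (Q p).IsPrimary ∧ (Q p).radical = p)
    (hdec : I = ⨅ p ∈ associatedPrimes S (S ⧸ I), Q p)
    (hirr : ∀ p ∈ associatedPrimes S (S ⧸ I),
      I ≠ ⨅ q ∈ associatedPrimes S (S ⧸ I) \ {p}, Q q)
    (D : ℕ → Ideal S) (hD0 : D 0 = I)
    (hD : ∀ i : ℕ, D (i + 1) =
      ⨅ p ∈ {p | p ∈ associatedPrimes S (S ⧸ I) ∧
        (i : WithBot ℕ∞) < ringKrullDim (S ⧸ p)}, Q p) :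
    IsPrettyClean I ↔
      ∀ i < 4, Submodule.map (D i).mkQ (D (i + 1)) ≠ ⊥ →
        IsCM S m4 ↥(Submodule.map (D i).mkQ (D (i + 1))) := by
  have hS := hI.suppClosed
  have hDsat : ∀ d ≤ 4, D d = PrettyClean.satDim d I := by
    rintro (_ | d) hd
    · rw [hD0, PrettyClean.satDim_zero]
    · rw [hD, PrettyClean.iInf_primary_eq_satDim hS Q hQ hdec]
  rw [PrettyClean.isPrettyClean_iff hS]
  refine forall₂_congr fun d hd ↦ ?_
  rw [hDsat d (by lia), hDsat (d + 1) (by lia)]
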